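/- arXiv:0704.3693 — 3 statements merged into one kernel-verified Lean document; each statement's English description precedes it below -/
import Mathlib

section
/- For every pair of vertices 0 ≤ p, q ≤ n and all natural numbers z₁, z₂ with z₁ + a z₂ ≡ i_q − i_p (mod r), there is a path in the labelled quiver from vertex p to vertex q with total label (z₁, z₂). (Every homomorphism between any two special Cohen–Macaulay modules S_{i_p} → S_{i_q} can be seen in the diagram; this encodes the surjectivity of the natural map from the path algebra of the quiver onto End_R(⊕_{p=0}^{n} S_{i_p}).) -/
/-- The two-step linear recursion `s₀ = x0`, `s₁ = x1`, `s_{t+1} = α_t s_t − s_{t−1}`;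
with `x0 = r, x1 = a` this is the i-series and with `x0 = 0, x1 = 1` the j-series. -/
def ser (x0 x1 : ℤ) (α : ℕ → ℕ) : ℕ → ℤ
  | 0 => x0
  | 1 => x1
  | t + 2 => (α (t + 1) : ℤ) * ser x0 x1 α (t + 1) - ser x0 x1 α t

/-- Hirzebruch–Jung (negative) continued fraction value of a list. -/
def hj : List ℚ → ℚ
  | [] => 0
  | q :: L => q - 1 / hj L

/-- `Arrow r a n α v w ℓ` : there is an arrow `v → w` with label `ℓ = (ℓ₁, ℓ₂)` in the
labelled quiver of the diagram of special CM modules: clockwise arrows `t → t−1` with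
label `(i_{t−1} − i_t, 0)` and `0 → n` with label `(1,0)`; anticlockwise arrows
`t → t+1` with label `(0, j_{t+1} − j_t)` and `n → 0` with label `(0, r − jₙ)`; and for
`1 ≤ t ≤ n`, `1 ≤ s ≤ α_t − 2`, extra arrows `t → 0` with label
`(i_{t−1} − (s+1) i_t, s j_t − j_{t−1})`. -/
def Arrow (r a n : ℕ) (α : ℕ → ℕ) (v w : ℕ) (ℓ : ℕ × ℕ) : Prop :=
  (∃ t, 1 ≤ t ∧ t ≤ n ∧ v = t ∧ w = t - 1 ∧
    ℓ = ((ser r a α (t - 1) - ser r a α t).toNat, 0)) ∨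
  (v = 0 ∧ w = n ∧ ℓ = (1, 0)) ∨
  (∃ t, t + 1 ≤ n ∧ v = t ∧ w = t + 1 ∧
    ℓ = (0, (ser 0 1 α (t + 1) - ser 0 1 α t).toNat)) ∨
  (v = n ∧ w = 0 ∧ ℓ = (0, ((r : ℤ) - ser 0 1 α n).toNat)) ∨
  (∃ t s, 1 ≤ t ∧ t ≤ n ∧ 1 ≤ s ∧ s ≤ α t - 2 ∧ v = t ∧ w = 0 ∧
    ℓ = ((ser r a α (t - 1) - ((s : ℤ) + 1) * ser r a α t).toNat,
         ((s : ℤ) * ser 0 1 α t - ser 0 1 α (t - 1)).toNat))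

/-- One step of the labelled quiver: move along an arrow, adding its label to the
running total. -/
def StepQ (r a n : ℕ) (α : ℕ → ℕ) (x y : ℕ × ℕ × ℕ) : Prop :=
  ∃ ℓ : ℕ × ℕ, Arrow r a n α x.1 y.1 ℓ ∧ y.2.1 = x.2.1 + ℓ.1 ∧ y.2.2 = x.2.2 + ℓ.2

/-- There is a path from vertex `p` to vertex `q` with total label `(z₁, z₂)`. -/
def HasPath (r a n : ℕ) (α : ℕ → ℕ) (p q z₁ z₂ : ℕ) : Prop :=
  Relation.ReflTransGen (StepQ r a n α) (p, 0, 0) (q, z₁, z₂)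


theorem ser_add_two (x0 x1 : ℤ) (α : ℕ → ℕ) (t : ℕ) :
    ser x0 x1 α (t + 2) = α (t + 1) * ser x0 x1 α (t + 1) - ser x0 x1 α t := rfl

theorem ser_shift (x0 x1 : ℤ) (α : ℕ → ℕ) (t : ℕ) :
    ser x0 x1 α (t + 1) = ser x1 (α 1 * x1 - x0) (fun s => α (s + 1)) t := by
  induction t using Nat.twoStepInduction with
  | zero => rfl
  | one => rfl
  | more t h₁ h₂ =>
    rw [ser_add_two, h₁, h₂, ser_add_two]

theorem hj_range_succ (α : ℕ → ℕ) (n : ℕ) :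
    hj ((List.range (n + 1)).map fun t => (α (t + 1) : ℚ)) =
      α 1 - 1 / hj ((List.range n).map fun t => (α (t + 1 + 1) : ℚ)) := by
  rw [List.range_succ_eq_map, List.map_cons, List.map_map, hj]
  rfl

theorem one_lt_hj (n : ℕ) (α : ℕ → ℕ) (hα : ∀ t, 1 ≤ t → t ≤ n + 1 → 2 ≤ α t) :
    1 < hj ((List.range (n + 1)).map fun t => (α (t + 1) : ℚ)) := by
  induction n generalizing α with
  | zero =>
    have h : (2 : ℚ) ≤ α 1 := by exact_mod_cast hα 1 le_rfl (by omega)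
    rw [hj_range_succ]
    simp only [List.range_zero, List.map_nil, hj, div_zero]
    linarith
  | succ n ih =>
    have h : (2 : ℚ) ≤ α 1 := by exact_mod_cast hα 1 le_rfl (by omega)
    have h' := ih (fun t => α (t + 1)) fun t h1 h2 => hα (t + 1) (by omega) (by omega)
    rw [hj_range_succ]
    have := (div_lt_one (by linarith)).2 h'
    linarith

/-- The series attached to a continued fraction expansion of `x0 / x1` decreases strictly
to zero. -/
theorem ser_decreasing_of_hj_eq (n : ℕ) (α : ℕ → ℕ) (x0 x1 : ℤ) (hx : 0 < x1)
    (hα : ∀ t, 1 ≤ t → t ≤ n + 1 → 2 ≤ α t)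
    (h : hj ((List.range (n + 1)).map fun t => (α (t + 1) : ℚ)) = (x0 : ℚ) / x1) :
    (∀ t ≤ n + 1, ser x0 x1 α (t + 1) < ser x0 x1 α t) ∧ ser x0 x1 α (n + 2) = 0 := by
  have hx' : (0 : ℚ) < x1 := by exact_mod_cast hx
  have h01 : x1 < x0 := by
    have := one_lt_hj n α hα
    rw [h, one_lt_div hx'] at this
    exact_mod_cast this
  induction n generalizing α x0 x1 with
  | zero =>
    rw [hj_range_succ] at h
    simp only [List.range_zero, List.map_nil, hj, div_zero, sub_zero] at h
    rw [eq_div_iff hx'.ne'] at h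
    have h2 : (α 1 : ℤ) * x1 = x0 := by exact_mod_cast h
    have h3 : ser x0 x1 α 2 = 0 := by
      rw [ser_add_two]
      simp only [ser]
      linarith
    refine ⟨fun t ht => ?_, h3⟩
    interval_cases t
    · exact h01
    · rw [h3]
      exact hx
  | succ n ih =>
    have hα' : ∀ t, 1 ≤ t → t ≤ n + 1 → 2 ≤ α (t + 1) :=
      fun t h1 h2 => hα (t + 1) (by omega) (by omega)
    have hgt := one_lt_hj n (fun t => α (t + 1)) hα'
    rw [hj_range_succ] at h
    set y := hj ((List.range (n + 1)).map fun t => (α (t + 1 + 1) : ℚ)) with hy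
    have hy0 : 0 < y := by linarith
    have hxy : (α 1 * x1 - x0 : ℚ) * y = x1 := by
      field_simp at h
      linarith
    have hpos : (0 : ℚ) < α 1 * x1 - x0 := by
      by_contra! hc
      nlinarith
    have hpos' : 0 < α 1 * x1 - x0 := by exact_mod_cast hpos
    have hy' : y = (x1 : ℚ) / ((α 1 * x1 - x0 : ℤ) : ℚ) := by
      rw [eq_div_iff (by push_cast; exact hpos.ne')]
      push_cast
      linarith
    have hlt : α 1 * x1 - x0 < x1 := by
      have : (α 1 * x1 - x0 : ℚ) < x1 := by nlinarith
      exact_mod_cast this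
    obtain ⟨h1, h2⟩ := ih (fun t => α (t + 1)) x1 (α 1 * x1 - x0) hpos' hα' hy'
      (by exact_mod_cast hpos) hlt
    refine ⟨fun t ht => ?_, ?_⟩
    · cases t with
      | zero => exact h01
      | succ t =>
        rw [ser_shift, ser_shift x0]
        exact h1 t (by omega)
    · rw [ser_shift]
      exact h2

theorem ser_lt_succ (n : ℕ) (α : ℕ → ℕ) (hα : ∀ t, 1 ≤ t → t ≤ n → 2 ≤ α t) (t : ℕ)
    (ht : t ≤ n) : 0 ≤ ser 0 1 α t ∧ ser 0 1 α t < ser 0 1 α (t + 1) := by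
  induction t with
  | zero => simp [ser]
  | succ t ih =>
    obtain ⟨h1, h2⟩ := ih (by omega)
    have h3 : (2 : ℤ) ≤ α (t + 1) := by exact_mod_cast hα (t + 1) (by omega) ht
    rw [ser_add_two]
    constructor <;> nlinarith

theorem dvd_ser_sub (r a : ℤ) (α : ℕ → ℕ) (t : ℕ) :
    r ∣ ser r a α t - a * ser 0 1 α t := by
  induction t using Nat.twoStepInduction with
  | zero => simp [ser]
  | one => simp [ser]
  | more t h₁ h₂ =>
    rw [ser_add_two, ser_add_two]
    refine ((h₂.mul_left (α (t + 1) : ℤ)).sub h₁).trans (dvd_of_eq ?_)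
    ring

theorem ser_mul_sub_ser_mul (r a : ℤ) (α : ℕ → ℕ) (t : ℕ) :
    ser r a α t * ser 0 1 α (t + 1) - ser r a α (t + 1) * ser 0 1 α t = r := by
  induction t with
  | zero => simp [ser]
  | succ t ih =>
    rw [ser_add_two, ser_add_two]
    linarith

/-- Consecutive pairs `(i_t, -j_t)` span the lattice of all `(u, v)` with `r ∣ u + a v`. -/
theorem exists_eq_combination (r a : ℤ) (α : ℕ → ℕ) (u v : ℤ) (h : r ∣ u + a * v) (t : ℕ) :
    ∃ A B : ℤ, u = A * ser r a α t + B * ser r a α (t + 1) ∧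
      v = -(A * ser 0 1 α t) - B * ser 0 1 α (t + 1) := by
  induction t with
  | zero =>
    obtain ⟨c, hc⟩ := h
    refine ⟨c, -v, ?_, ?_⟩ <;> simp only [ser] <;> linarith
  | succ t ih =>
    obtain ⟨A, B, hu, hv⟩ := ih
    refine ⟨A * α (t + 1) + B, -A, ?_, ?_⟩
    · rw [ser_add_two, hu]
      ring
    · rw [ser_add_two, hv]
      ring

/-- A lattice point translated by `(i, 0)` and lying in the first quadrant dominates
`(i, 0)` or `(0, j)`. -/
theorem le_or_le_of_combination {i' i j' j A B u v : ℤ} (hi : i < i') (hi0 : 0 < i)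
    (hj : j' < j) (hu0 : 0 ≤ u) (hv0 : 0 ≤ v)
    (hu : u - i = A * i' + B * i) (hv : v = -(A * j') - B * j) (hj0 : 0 ≤ j') :
    i ≤ u ∨ j ≤ v := by
  by_contra! hc
  obtain ⟨h1, h2⟩ := hc
  rcases lt_trichotomy A 0 with hA | hA | hA
  · have hB : -A < B + 1 := by
      by_contra! h
      nlinarith
    nlinarith
  · subst hA
    have hB : B < 0 := by
      by_contra! h
      nlinarith
    nlinarith
  · have hB : B + 1 < 1 - A := by
      by_contra! h
      nlinarith
    nlinarith

/-- A nonzero lattice point of the first quadrant to the left of `i'` dominates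
`(i' - s i, s j - j')` for some `s ≥ 1`. -/
theorem exists_le_of_combination {i' i j' j A B u v : ℤ} (hi : i < i') (hi0 : 0 < i)
    (hj : j' < j) (hj0 : 0 ≤ j') (hu0 : 0 ≤ u) (hv0 : 0 ≤ v) (hne : 0 < u ∨ 0 < v)
    (hlt : u < i') (hu : u = A * i' + B * i) (hv : v = -(A * j') - B * j) :
    ∃ s : ℤ, 1 ≤ s ∧ i' - s * i ≤ u ∧ s * j - j' ≤ v := by
  have hA : 0 < A := by
    by_contra! hA
    rcases hA.lt_or_eq with hA | hA
    · have hB : -A < B := by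
        by_contra! h
        nlinarith
      nlinarith
    · subst hA
      have h1 : 0 ≤ B := by
        by_contra! h
        nlinarith
      have h2 : B ≤ 0 := by
        by_contra! h
        nlinarith
      have h3 : B = 0 := le_antisymm h2 h1
      subst h3
      omega
  refine ⟨-B - (A - 1), ?_, ?_, ?_⟩
  · by_contra! h
    nlinarith
  · nlinarith
  · nlinarith

theorem HasPath.cons {r a n : ℕ} {α : ℕ → ℕ} {p w q z₁ z₂ : ℕ} {ℓ : ℕ × ℕ}
    (harr : Arrow r a n α p w ℓ) (h₁ : ℓ.1 ≤ z₁) (h₂ : ℓ.2 ≤ z₂)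
    (h : HasPath r a n α w q (z₁ - ℓ.1) (z₂ - ℓ.2)) : HasPath r a n α p q z₁ z₂ := by
  have hlift : Relation.ReflTransGen (StepQ r a n α) (w, ℓ.1 + 0, ℓ.2 + 0)
      (q, ℓ.1 + (z₁ - ℓ.1), ℓ.2 + (z₂ - ℓ.2)) :=
    Relation.ReflTransGen.lift (p := StepQ r a n α)
      (fun x : ℕ × ℕ × ℕ => (x.1, ℓ.1 + x.2.1, ℓ.2 + x.2.2)) (by
        rintro x y ⟨m, hm, e₁, e₂⟩
        refine ⟨m, hm, ?_, ?_⟩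
        · simp only [e₁, add_assoc]
        · simp only [e₂, add_assoc]) _ _ h
  rw [Nat.add_sub_cancel' h₁, Nat.add_sub_cancel' h₂] at hlift
  exact Relation.ReflTransGen.head
    ⟨ℓ, harr, Nat.add_comm ℓ.1 0, Nat.add_comm ℓ.2 0⟩ hlift

/-- Every monomial in the class of homomorphisms `p → q` is trivial or divisible by the
label of an arrow leaving `p`. -/
theorem exists_arrow_of_dvd (r a n : ℕ) (α : ℕ → ℕ) (ha : 0 < a)
    (hcop : Nat.Coprime r a) (hn : 1 ≤ n) (hα : ∀ t, 1 ≤ t → t ≤ n → 2 ≤ α t)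
    (hval : hj ((List.range n).map fun t => (α (t + 1) : ℚ)) = (r : ℚ) / (a : ℚ))
    {p q z₁ z₂ : ℕ} (hp : p ≤ n) (hq : q ≤ n)
    (hz : (r : ℤ) ∣ (z₁ + a * z₂) - (ser r a α q - ser r a α p)) :
    (p = q ∧ z₁ = 0 ∧ z₂ = 0) ∨ ∃ w ≤ n, ∃ ℓ : ℕ × ℕ, Arrow r a n α p w ℓ ∧
      ℓ.1 ≤ z₁ ∧ ℓ.2 ≤ z₂ ∧ 0 < ℓ.1 + ℓ.2 ∧
      (r : ℤ) ∣ (ℓ.1 + a * ℓ.2) - (ser r a α w - ser r a α p) := by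
  obtain ⟨hdec, hlast⟩ : (∀ t ≤ n, ser r a α (t + 1) < ser r a α t) ∧
      ser r a α (n + 1) = 0 := by
    obtain ⟨m, rfl⟩ : ∃ m, n = m + 1 := ⟨n - 1, by omega⟩
    exact ser_decreasing_of_hj_eq m α r a (by exact_mod_cast ha) hα
      (by rw [hval, Int.cast_natCast, Int.cast_natCast])
  have hanti : ∀ s t, s < t → t ≤ n + 1 → ser r a α t < ser r a α s := by
    intro s t hst
    induction t, hst using Nat.le_induction with
    | base => exact fun h => hdec s (by omega)
    | succ t hst ih => exact fun h => (hdec t (by omega)).trans (ih (by omega))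
  have hpos : ∀ t ≤ n, 0 < ser r a α t := fun t ht =>
    hlast ▸ hanti t (n + 1) (by omega) le_rfl
  have hJ := ser_lt_succ n α hα
  have hone : ser r a α n = 1 := by
    obtain ⟨A, B, hA, -⟩ := exists_eq_combination r a α r 0 (by simp) n
    obtain ⟨C, D, hC, -⟩ := exists_eq_combination r a α a (-1) (by simp) n
    rw [hlast, mul_zero, add_zero] at hA hC
    have hco : IsCoprime (r : ℤ) (a : ℤ) := Nat.isCoprime_iff_coprime.2 hcop
    have hu := hco.isUnit_of_dvd' ⟨A, by rw [mul_comm]; exact hA⟩ ⟨C, by rw [mul_comm]; exact hC⟩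
    rcases Int.isUnit_iff.1 hu with h | h
    · exact h
    · have := hpos n le_rfl
      omega
  have hr : ser 0 1 α (n + 1) = r := by
    have := ser_mul_sub_ser_mul r a α n
    rwa [hone, hlast, zero_mul, sub_zero, one_mul] at this
  by_cases hup : ser 0 1 α (p + 1) - ser 0 1 α p ≤ z₂
  · obtain ⟨w, hw, harr, hdvd⟩ : ∃ w ≤ n,
        Arrow r a n α p w (0, (ser 0 1 α (p + 1) - ser 0 1 α p).toNat) ∧
        (r : ℤ) ∣ ser r a α w - ser r a α (p + 1) := by
      rcases hp.lt_or_eq with h | h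
      · exact ⟨p + 1, h, Or.inr (Or.inr (Or.inl ⟨p, h, rfl, rfl, rfl⟩)), by simp⟩
      · subst h
        refine ⟨0, by omega, Or.inr (Or.inr (Or.inr (Or.inl ⟨rfl, rfl, ?_⟩))), ?_⟩
        · rw [hr]
        · rw [hlast, sub_zero]
          exact dvd_rfl
    have hlt := (hJ p hp).2
    refine Or.inr ⟨w, hw, _, harr, Nat.zero_le _, ?_, ?_, ?_⟩
    · dsimp only; omega
    · dsimp only; omega
    · dsimp only
      rw [Int.toNat_of_nonneg (by omega)]
      have e := ((dvd_ser_sub r a α p).sub (dvd_ser_sub r a α (p + 1))).sub hdvd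
      refine e.trans (dvd_of_eq ?_)
      push_cast
      ring
  rw [not_le] at hup
  cases p with
  | zero =>
    have hz2 : z₂ = 0 := by
      simp only [ser] at hup
      omega
    rcases Nat.eq_zero_or_pos z₁ with h | h
    · left
      refine ⟨?_, h, hz2⟩
      by_contra hq0
      subst h hz2
      have h1 := hanti 0 q (by omega) (by omega)
      have h2 := hpos q hq
      have h3 : (r : ℤ) ∣ ser r a α q := by
        have := (dvd_refl (r : ℤ)).sub hz
        simpa [ser] using this
      have := Int.le_of_dvd h2 h3
      simp only [ser] at h1
      omega
    · refine Or.inr ⟨n, le_rfl, (1, 0), Or.inr (Or.inl ⟨rfl, rfl, rfl⟩), h, Nat.zero_le _,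
        by simp, ?_⟩
      rw [hone]
      simp [ser]
  | succ k =>
    have hk := hdec k (by omega)
    by_cases hdown : ser r a α k - ser r a α (k + 1) ≤ z₁
    · refine Or.inr ⟨k, by omega, _, Or.inl ⟨k + 1, by omega, hp, rfl, rfl, rfl⟩, ?_,
        Nat.zero_le _, ?_, ?_⟩
      · simp only [Nat.add_sub_cancel]; omega
      · simp only [Nat.add_sub_cancel]; omega
      · simp only [Nat.add_sub_cancel]
        rw [Int.toNat_of_nonneg (by omega)]
        simp
    rw [not_le] at hdown
    have hpk := hpos (k + 1) hp
    obtain ⟨hjk, hjlt⟩ := hJ k (by omega)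
    have hz' : (r : ℤ) ∣ (z₁ + ser r a α (k + 1) - ser r a α q) + a * z₂ := by
      refine hz.trans (dvd_of_eq ?_)
      ring
    have hor : ser r a α q ≤ z₁ + ser r a α (k + 1) ∨ ser 0 1 α q ≤ z₂ := by
      cases q with
      | zero =>
        right
        simp [ser]
      | succ m =>
        obtain ⟨A, B, hA, hB⟩ := exists_eq_combination r a α _ _ hz' m
        exact le_or_le_of_combination (hdec m (by omega)) (hpos (m + 1) hq) (hJ m (by omega)).2
          (by omega) (by omega) hA hB (hJ m (by omega)).1
    have hjq := (hJ q hq).1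
    have hqpos := hpos q hq
    by_cases htriv : ser r a α q = z₁ + ser r a α (k + 1) ∧ z₂ = 0
    · left
      obtain ⟨h1, h2⟩ := htriv
      have h3 : k + 1 = q := by
        rcases lt_trichotomy (k + 1) q with h | h | h
        · have := hanti _ _ h (by omega)
          omega
        · exact h
        · rcases (Nat.lt_succ_iff.1 h).lt_or_eq with h' | h'
          · have := hanti q k h' (by omega)
            omega
          · subst h'
            omega
      subst h3
      exact ⟨rfl, by omega, h2⟩
    obtain ⟨s, hs1, hsu, hsv⟩ : ∃ s : ℤ, 1 ≤ s ∧
        ser r a α k - s * ser r a α (k + 1) ≤ z₁ + ser r a α (k + 1) ∧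
        s * ser 0 1 α (k + 1) - ser 0 1 α k ≤ z₂ := by
      rcases hor with h | h
      · obtain ⟨A, B, hA, hB⟩ := exists_eq_combination r a α _ _ hz' k
        obtain ⟨s, h1, h2, h3⟩ := exists_le_of_combination hk hpk hjlt hjk (by omega) (by omega)
          (by omega) (by omega) hA hB
        exact ⟨s, h1, by omega, h3⟩
      · have hz'' : (r : ℤ) ∣ (z₁ + ser r a α (k + 1)) + a * (z₂ - ser 0 1 α q) := by
          refine (hz'.add (dvd_ser_sub r a α q)).trans (dvd_of_eq ?_)
          ring
        obtain ⟨A, B, hA, hB⟩ := exists_eq_combination r a α _ _ hz'' k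
        obtain ⟨s, h1, h2, h3⟩ := exists_le_of_combination hk hpk hjlt hjk (by omega) (by omega)
          (by omega) (by omega) hA hB
        exact ⟨s, h1, h2, by omega⟩
    rw [ser_add_two] at hup
    have hsα : s < α (k + 1) - 1 := by
      by_contra! h
      nlinarith
    have hi2 := hdec (k + 1) hp
    rw [ser_add_two] at hi2
    have hnext : 0 ≤ ser r a α (k + 2) := by
      rcases hp.lt_or_eq with h | h
      · exact (hpos (k + 2) h).le
      · subst h
        exact hlast.ge
    rw [ser_add_two] at hnext
    have hx0 : 0 ≤ ser r a α k - (s + 1) * ser r a α (k + 1) := by nlinarith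
    have hy0 : 0 < s * ser 0 1 α (k + 1) - ser 0 1 α k := by nlinarith
    lift s to ℕ using by omega
    refine Or.inr ⟨0, by omega, _, Or.inr (Or.inr (Or.inr (Or.inr
      ⟨k + 1, s, by omega, hp, by omega, by omega, rfl, rfl, rfl⟩))), ?_, ?_, ?_, ?_⟩
    all_goals simp only [Nat.add_sub_cancel]
    · rw [Int.toNat_le]
      linarith
    · rw [Int.toNat_le]
      exact hsv
    · omega
    · rw [Int.toNat_of_nonneg hx0, Int.toNat_of_nonneg hy0.le]
      refine (((dvd_ser_sub r a α k).sub ((dvd_ser_sub r a α (k + 1)).mul_left s)).sub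
        (dvd_refl (r : ℤ))).trans (dvd_of_eq ?_)
      simp only [ser]
      ring

theorem hasPath_of_dvd (r a n : ℕ) (α : ℕ → ℕ) (ha : 0 < a)
    (hcop : Nat.Coprime r a) (hn : 1 ≤ n) (hα : ∀ t, 1 ≤ t → t ≤ n → 2 ≤ α t)
    (hval : hj ((List.range n).map fun t => (α (t + 1) : ℚ)) = (r : ℚ) / (a : ℚ))
    {q : ℕ} (hq : q ≤ n) (N p z₁ z₂ : ℕ) (hp : p ≤ n) (hN : z₁ + z₂ ≤ N)
    (hz : (r : ℤ) ∣ (z₁ + a * z₂) - (ser r a α q - ser r a α p)) :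
    HasPath r a n α p q z₁ z₂ := by
  induction N generalizing p z₁ z₂ with
  | zero =>
    rcases exists_arrow_of_dvd r a n α ha hcop hn hα hval hp hq hz with
      ⟨rfl, rfl, rfl⟩ | ⟨w, hw, ℓ, harr, h₁, h₂, h₃, hd⟩
    · exact Relation.ReflTransGen.refl
    · omega
  | succ N ih =>
    rcases exists_arrow_of_dvd r a n α ha hcop hn hα hval hp hq hz with
      ⟨rfl, rfl, rfl⟩ | ⟨w, hw, ℓ, harr, h₁, h₂, h₃, hd⟩
    · exact Relation.ReflTransGen.refl
    · refine HasPath.cons harr h₁ h₂ (ih w _ _ hw (by omega) ?_)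
      push_cast [h₁, h₂]
      refine (hz.sub hd).trans (dvd_of_eq ?_)
      ring

/-- every homomorphism between any two special Cohen-Macaulay modules
`S_{i_p} -> S_{i_q}` can be seen in the diagram (surjectivity of the natural map from
the path algebra onto the endomorphism ring of the special CM modules). -/
theorem stmt_11 (r a n : ℕ) (α : ℕ → ℕ)
    (ha : 1 ≤ a) (har : a < r) (hcop : Nat.Coprime r a) (hn : 1 ≤ n)
    (hα : ∀ t, 1 ≤ t → t ≤ n → 2 ≤ α t)
    (hval : hj ((List.range n).map fun t => (α (t + 1) : ℚ)) = (r : ℚ) / (a : ℚ)) :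
    ∀ p q, p ≤ n → q ≤ n → ∀ z₁ z₂ : ℕ,
      ((z₁ : ℤ) + (a : ℤ) * (z₂ : ℤ)) ≡ ser r a α q - ser r a α p [ZMOD (r : ℤ)] →
      HasPath r a n α p q z₁ z₂ := by
  intro p q hp hq z₁ z₂ hz
  exact hasPath_of_dvd r a n α ha hcop hn hα hval
    hq _ p z₁ z₂ hp le_rfl hz.symm.dvd
end

section
/- If a = r − 1 then Λ has global dimension 2: Ext³_Λ(M,N) = 0 for all left Λ-modules M, N, and Ext²_Λ(M,N) ≠ 0 for some left Λ-modules M, N. If a ≠ r − 1 then Λ has global dimension 3: Ext⁴_Λ(M,N) = 0 for all left Λ-modules M, N, and Ext³_Λ(M,N) ≠ 0 for some left Λ-modules M, N. -/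
open MvPolynomial

/-- The invariant subalgebra `R = {p ∈ ℂ[x,y] | g p = p}`. -/
noncomputable def fixedSub (g : MvPolynomial (Fin 2) ℂ ≃ₐ[ℂ] MvPolynomial (Fin 2) ℂ) :
    Subalgebra ℂ (MvPolynomial (Fin 2) ℂ) :=
  AlgHom.equalizer g.toAlgHom (AlgHom.id ℂ _)

/-- The `R`-submodule `S_c = {f ∈ ℂ[x,y] | g f = c·f}` (eigenspace of the group action),
where `R = fixedSub g` is the invariant ring.  For `c = ε^t` this is the module `S_t`. -/
noncomputable def eigenSub (g : MvPolynomial (Fin 2) ℂ ≃ₐ[ℂ] MvPolynomial (Fin 2) ℂ)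
    (c : ℂ) : Submodule (fixedSub g) (MvPolynomial (Fin 2) ℂ) where
  carrier := {f | g f = C c * f}
  add_mem' := by
    intro f₁ f₂ h1 h2
    simp only [Set.mem_setOf_eq] at *
    rw [map_add, h1, h2, mul_add]
  zero_mem' := by simp
  smul_mem' := by
    intro s f hf
    simp only [Set.mem_setOf_eq] at *
    rw [Algebra.smul_def, map_mul, hf]
    have hs : g (algebraMap (fixedSub g) (MvPolynomial (Fin 2) ℂ) s) =
        algebraMap (fixedSub g) (MvPolynomial (Fin 2) ℂ) s := s.2
    rw [hs]
    ring

section ShortcutInstances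

variable (g : MvPolynomial (Fin 2) ℂ ≃ₐ[ℂ] MvPolynomial (Fin 2) ℂ)

set_option synthInstance.maxHeartbeats 1000000
set_option maxHeartbeats 4000000

/-- shortcut instance (for performance only) -/
noncomputable instance fixedSub.instCommRing : CommRing (fixedSub g) :=
  Subalgebra.toCommRing _

/-- shortcut instance (for performance only) -/
noncomputable instance eigenSub.instAddCommGroup (c : ℂ) : AddCommGroup (eigenSub g c) :=
  inferInstance

/-- shortcut instance (for performance only) -/
noncomputable instance eigenSub.instModule (c : ℂ) :
    Module (fixedSub g) (eigenSub g c) := inferInstance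

/-- shortcut instance (for performance only) -/
noncomputable instance eigenSub.instEndAlgebra (n : ℕ) (c : Fin (n + 1) → ℂ) :
    Algebra (fixedSub g) (Module.End (fixedSub g) ((p : Fin (n + 1)) → eigenSub g (c p))) :=
  inferInstance

end ShortcutInstances

open CategoryTheory

/-- The derived-functor `Ext` vanishes iff the derived-category `Ext` does (positive degrees). -/
theorem subsingleton_derived_ext_iff {Λ : Type} [Ring Λ] (M N : ModuleCat.{0} Λ) (n : ℕ) :
    Subsingleton (((Ext ℤ (ModuleCat.{0} Λ) (n + 1)).obj (Opposite.op M)).obj N) ↔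
      Subsingleton (Abelian.Ext.{0} M N (n + 1)) := by
  let P := projectiveResolution M
  rw [← ModuleCat.isZero_iff_subsingleton, (P.isoExt (R := ℤ) (n + 1) N).isZero_iff,
    ← HomologicalComplex.exactAt_iff_isZero_homology,
    HomologicalComplex.exactAt_iff' _ n (n + 1) (n + 2) (by simp) (by simp),
    ShortComplex.moduleCat_exact_iff]
  constructor
  · intro h
    refine subsingleton_of_forall_eq 0 fun e => ?_
    obtain ⟨f, hf, rfl⟩ := P.extMk_surjective e (n + 2) rfl
    rw [P.extMk_eq_zero_iff f (n + 2) rfl hf n rfl]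
    exact h f hf
  · intro h f hf
    exact (P.extMk_eq_zero_iff f (n + 2) rfl hf n rfl).1 (Subsingleton.elim _ _)

theorem forall_subsingleton_derived_ext_iff {Λ : Type} [Ring Λ] (M : ModuleCat.{0} Λ) (n : ℕ) :
    (∀ N, Subsingleton (((Ext ℤ (ModuleCat.{0} Λ) (n + 1)).obj (Opposite.op M)).obj N)) ↔
      HasProjectiveDimensionLT M (n + 1) := by
  simp only [subsingleton_derived_ext_iff]
  exact ⟨hasProjectiveDimensionLT_of_enoughInjectives M (n + 1),
    fun h N => HasProjectiveDimensionLT.subsingleton M (n + 1) (n + 1) le_rfl N⟩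

/-- `M` has projective dimension `< n`, for an unbundled module. -/
abbrev ProjDimLT (R : Type) [Ring R] (n : ℕ) (M : Type) [AddCommGroup M] [Module R M] : Prop :=
  HasProjectiveDimensionLT (ModuleCat.of R M) n

namespace ProjDimLT

variable {R : Type} [Ring R] {A B C : Type} [AddCommGroup A] [AddCommGroup B] [AddCommGroup C]
  [Module R A] [Module R B] [Module R C] {n : ℕ}

theorem one_iff : ProjDimLT R 1 A ↔ Module.Projective R A := by
  rw [ProjDimLT, ← projective_iff_hasProjectiveDimensionLT_one]
  exact (IsProjective.iff_projective (R := R) A).symm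

theorem of_projective [Module.Projective R A] (hn : 1 ≤ n) : ProjDimLT R n A :=
  have : ProjDimLT R 1 A := one_iff.2 inferInstance
  hasProjectiveDimensionLT_of_ge _ 1 n hn

theorem of_subsingleton [Subsingleton A] : ProjDimLT R n A :=
  have := (ModuleCat.isZero_of_subsingleton (ModuleCat.of R A)).hasProjectiveDimensionLT_zero
  hasProjectiveDimensionLT_of_ge _ 0 n n.zero_le

theorem mono {m : ℕ} (h : ProjDimLT R m A) (hmn : m ≤ n) : ProjDimLT R n A :=
  hasProjectiveDimensionLT_of_ge _ m n hmn

theorem of_linearEquiv (h : ProjDimLT R n A) (e : A ≃ₗ[R] B) : ProjDimLT R n B :=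
  hasProjectiveDimensionLT_of_iso e.toModuleIso n

theorem of_retract (h : ProjDimLT R n A) (i : B →ₗ[R] A) (p : A →ₗ[R] B)
    (hpi : ∀ b, p (i b) = b) : ProjDimLT R n B :=
  Retract.hasProjectiveDimensionLT (Y := ModuleCat.of R A)
    { i := ModuleCat.ofHom i, r := ModuleCat.ofHom p, retract := by ext b; exact hpi b } n

theorem shortExact {f : A →ₗ[R] B} {g : B →ₗ[R] C} (hf : Function.Injective f)
    (hfg : Function.Exact f g) (hg : Function.Surjective g) :
    (ShortComplex.mk (ModuleCat.ofHom f) (ModuleCat.ofHom g)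
      (by ext x; exact hfg.apply_apply_eq_zero x)).ShortExact :=
  { exact := (ShortComplex.ShortExact.moduleCat_exact_iff_function_exact _).2 hfg
    mono_f := (ModuleCat.mono_iff_injective _).2 hf
    epi_g := (ModuleCat.epi_iff_surjective _).2 hg }

variable {f : A →ₗ[R] B} {g : B →ₗ[R] C}

theorem middle (hf : Function.Injective f) (hfg : Function.Exact f g)
    (hg : Function.Surjective g) (hA : ProjDimLT R n A) (hC : ProjDimLT R n C) :
    ProjDimLT R n B :=
  (shortExact hf hfg hg).hasProjectiveDimensionLT_X₂ n hA hC

theorem right (hf : Function.Injective f) (hfg : Function.Exact f g)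
    (hg : Function.Surjective g) (hA : ProjDimLT R n A) (hB : ProjDimLT R (n + 1) B) :
    ProjDimLT R (n + 1) C :=
  (shortExact hf hfg hg).hasProjectiveDimensionLT_X₃ n hA hB

theorem left (hf : Function.Injective f) (hfg : Function.Exact f g)
    (hg : Function.Surjective g) (hB : ProjDimLT R n B) (hC : ProjDimLT R (n + 1) C) :
    ProjDimLT R n A :=
  (shortExact hf hfg hg).hasProjectiveDimensionLT_X₁ n hB hC

theorem ker_of_surjective (hg : Function.Surjective g) (hB : ProjDimLT R n B)
    (hC : ProjDimLT R (n + 1) C) : ProjDimLT R n (LinearMap.ker g) :=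
  left (LinearMap.ker g).injective_subtype (LinearMap.exact_subtype_ker_map g) hg hB hC

theorem prod (hA : ProjDimLT R n A) (hB : ProjDimLT R n B) : ProjDimLT R n (A × B) :=
  middle (f := LinearMap.inl R A B) (g := LinearMap.snd R A B) LinearMap.inl_injective
    .inl_snd LinearMap.snd_surjective hA hB

section Submodule

variable (P Q : Submodule R A)

/-- The antidiagonal inclusion of an intersection of submodules. -/
def interToProd : ↥(P ⊓ Q) →ₗ[R] P × Q :=
  (Submodule.inclusion inf_le_left).prod (-Submodule.inclusion inf_le_right)

/-- The sum map onto the supremum of two submodules. -/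
def prodToSup : P × Q →ₗ[R] ↥(P ⊔ Q) :=
  (Submodule.inclusion le_sup_left).coprod (Submodule.inclusion le_sup_right)

theorem interToProd_injective : Function.Injective (interToProd P Q) := fun _ _ h =>
  Submodule.inclusion_injective _ (Prod.ext_iff.1 h).1

theorem prodToSup_surjective : Function.Surjective (prodToSup P Q) := by
  rintro ⟨x, hx⟩
  obtain ⟨p, hp, q, hq, rfl⟩ := Submodule.mem_sup.1 hx
  exact ⟨(⟨p, hp⟩, ⟨q, hq⟩), rfl⟩

theorem interToProd_exact : Function.Exact (interToProd P Q) (prodToSup P Q) := by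
  rintro ⟨⟨p, hp⟩, ⟨q, hq⟩⟩
  constructor
  · intro h
    have h' : p + q = 0 := congrArg Subtype.val h
    obtain rfl : q = -p := by rw [eq_neg_iff_add_eq_zero, add_comm, h']
    exact ⟨⟨p, hp, neg_mem_iff.1 hq⟩, rfl⟩
  · rintro ⟨x, hx⟩
    rw [← hx]
    exact Subtype.ext (add_neg_cancel (x : A))

variable {P Q}

theorem sup (hPQ : ProjDimLT R n ↥(P ⊓ Q)) (hP : ProjDimLT R (n + 1) P)
    (hQ : ProjDimLT R (n + 1) Q) : ProjDimLT R (n + 1) ↥(P ⊔ Q) :=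
  right (interToProd_injective P Q) (interToProd_exact P Q) (prodToSup_surjective P Q) hPQ
    (hP.prod hQ)

theorem inf (hPQ : ProjDimLT R (n + 1) ↥(P ⊔ Q)) (hP : ProjDimLT R n P)
    (hQ : ProjDimLT R n Q) : ProjDimLT R n ↥(P ⊓ Q) :=
  left (interToProd_injective P Q) (interToProd_exact P Q) (prodToSup_surjective P Q)
    (hP.prod hQ) hPQ

end Submodule

theorem finsupp (J : Type) (hA : ProjDimLT R (n + 1) A) : ProjDimLT R (n + 1) (J →₀ A) := by
  classical
  induction n generalizing A with
  | zero =>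
    have := one_iff.1 hA
    exact one_iff.2 (.of_equiv (finsuppLequivDFinsupp (ι := J) (M := A) R).symm)
  | succ n ih =>
    have hs := Finsupp.linearCombination_id_surjective R A
    have hK := ih (ker_of_surjective hs (of_projective (by omega)) hA)
    refine right (f := Finsupp.mapRange.linearMap (LinearMap.ker _).subtype)
      (g := Finsupp.mapRange.linearMap (α := J) (Finsupp.linearCombination R (id : A → A)))
      ?_ ?_ ?_ hK (of_projective (by omega))
    · exact Finsupp.mapRange_injective _ rfl (Submodule.injective_subtype _)
    · intro x
      constructor
      · intro hx
        have hx' : ∀ j, Finsupp.linearCombination R (id : A → A) (x j) = 0 := fun j => by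
          simpa using DFunLike.congr_fun hx j
        refine ⟨Finsupp.onFinset x.support (fun j => ⟨x j, hx' j⟩) fun j hj => ?_, ?_⟩
        · exact Finsupp.mem_support_iff.2 fun h => hj (Subtype.ext h)
        · ext1 j
          simp
      · rintro ⟨y, rfl⟩
        ext1 j
        simp
    · exact Finsupp.mapRange_surjective _ (map_zero _) hs

end ProjDimLT

/-- Every `R`-module has projective dimension `< n`. -/
def GlDimLT (R : Type) [Ring R] (n : ℕ) : Prop :=
  ∀ (M : Type) [AddCommGroup M] [Module R M], ProjDimLT R n M

namespace GlDimLT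

attribute [local instance] RingHomInvPair.of_ringEquiv in
theorem of_ringEquiv {R R' : Type} [Ring R] [Ring R'] {n : ℕ} (e : R ≃+* R')
    (h : GlDimLT R (n + 1)) : GlDimLT R' (n + 1) := by
  intro M _ _
  let : Module R M := Module.compHom M (e : R →+* R')
  let e' : M ≃ₛₗ[RingHomClass.toRingHom e] M :=
    { AddEquiv.refl M with map_smul' := fun r m => rfl }
  have : HasProjectiveDimensionLE (ModuleCat.of R M) n := h M
  exact ModuleCat.hasProjectiveDimensionLE_of_semiLinearEquiv e (M := ModuleCat.of R M)
    (N := ModuleCat.of R' M) e' n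

theorem of_field (K : Type) [Field K] : GlDimLT K 1 := fun _ _ _ =>
  ProjDimLT.of_projective le_rfl

section Polynomial

open scoped Polynomial TensorProduct

variable {R : Type} [CommRing R]

theorem _root_.ProjDimLT.polynomial_tensor {n : ℕ} (M : Type) [AddCommGroup M] [Module R M]
    (h : ProjDimLT R (n + 1) M) : ProjDimLT R[X] (n + 1) (R[X] ⊗[R] M) := by
  induction n generalizing M with
  | zero =>
    have := ProjDimLT.one_iff.1 h
    exact ProjDimLT.one_iff.2 inferInstance
  | succ n ih =>
    have hs := Finsupp.linearCombination_id_surjective R M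
    have hK := ih _ (ProjDimLT.ker_of_surjective hs (ProjDimLT.of_projective (by omega)) h)
    refine ProjDimLT.right
      (f := (LinearMap.ker (Finsupp.linearCombination R (id : M → M))).subtype.baseChange R[X])
      (g := (Finsupp.linearCombination R (id : M → M)).baseChange R[X])
      ?_ ?_ ?_ hK (ProjDimLT.of_projective (by omega))
    · exact Module.Flat.lTensor_preserves_injective_linearMap _ (Submodule.injective_subtype _)
    · exact lTensor_exact R[X] (LinearMap.exact_subtype_ker_map _) hs
    · exact LinearMap.lTensor_surjective R[X] hs

variable (M : Type) [AddCommGroup M] [Module R[X] M]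

variable [Module R M] [IsScalarTower R R[X] M]

/-- Multiplication by `X ⊗ 1 - 1 ⊗ X` on `R[X] ⊗ M`. -/
noncomputable def xSubX : R[X] ⊗[R] M →ₗ[R[X]] R[X] ⊗[R] M :=
  LinearMap.lsmul R[X] _ Polynomial.X -
    ((LinearMap.lsmul R[X] M Polynomial.X).restrictScalars R).baseChange R[X]

/-- The action map `R[X] ⊗ M → M`. -/
noncomputable def actionMap : R[X] ⊗[R] M →ₗ[R[X]] M :=
  TensorProduct.AlgebraTensorModule.lift (LinearMap.toSpanSingleton R[X] _ LinearMap.id)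

variable {M}

theorem xSubX_tmul (p : R[X]) (m : M) :
    xSubX M (p ⊗ₜ[R] m) = (Polynomial.X * p) ⊗ₜ m - p ⊗ₜ ((Polynomial.X : R[X]) • m) := rfl

theorem actionMap_tmul (p : R[X]) (m : M) : actionMap M (p ⊗ₜ[R] m) = p • m := rfl

theorem actionMap_xSubX (t : R[X] ⊗[R] M) : actionMap M (xSubX M t) = 0 := by
  induction t with
  | zero => simp
  | add x y hx hy => simp [hx, hy]
  | tmul p m => simp [xSubX_tmul, actionMap_tmul, mul_smul, smul_comm p]

theorem exists_eq_xSubX_add (t : R[X] ⊗[R] M) : ∃ s, t = xSubX M s + 1 ⊗ₜ actionMap M t := by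
  induction t with
  | zero => exact ⟨0, by simp⟩
  | add x y hx hy =>
    obtain ⟨s, hs⟩ := hx
    obtain ⟨s', hs'⟩ := hy
    refine ⟨s + s', ?_⟩
    conv_lhs => rw [hs, hs']
    simp only [map_add, TensorProduct.tmul_add]
    abel
  | tmul p m =>
    induction p using Polynomial.induction_on' with
    | add p q hp hq =>
      obtain ⟨s, hs⟩ := hp
      obtain ⟨s', hs'⟩ := hq
      refine ⟨s + s', ?_⟩
      rw [TensorProduct.add_tmul]
      conv_lhs => rw [hs, hs']
      simp only [map_add, TensorProduct.tmul_add]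
      abel
    | monomial n r =>
      induction n generalizing m with
      | zero =>
        refine ⟨0, ?_⟩
        have h : Polynomial.monomial 0 r = r • (1 : R[X]) := by
          rw [Polynomial.smul_eq_C_mul, mul_one, Polynomial.monomial_zero_left]
        rw [actionMap_tmul, h, smul_assoc, one_smul, TensorProduct.smul_tmul, map_zero, zero_add]
      | succ n ih =>
        obtain ⟨s, hs⟩ := ih ((Polynomial.X : R[X]) • m)
        refine ⟨s + Polynomial.monomial n r ⊗ₜ m, ?_⟩
        have hX : Polynomial.monomial (n + 1) r = Polynomial.X * Polynomial.monomial n r :=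
          (Polynomial.X_mul_monomial n r).symm
        have ha : actionMap M (Polynomial.monomial (n + 1) r ⊗ₜ[R] m) =
            actionMap M (Polynomial.monomial n r ⊗ₜ[R] ((Polynomial.X : R[X]) • m)) := by
          rw [actionMap_tmul, actionMap_tmul, hX, mul_comm, mul_smul]
        rw [ha, map_add, add_right_comm, ← hs, xSubX_tmul, hX]
        abel

theorem xSubX_injective : Function.Injective (xSubX (R := R) M) := by
  let c := TensorProduct.equivFinsuppOfBasisLeft (N := M) (Polynomial.basisMonomials R)
  have hc : ∀ (t : R[X] ⊗[R] M) (i : ℕ),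
      c (xSubX M t) (i + 1) = c t i - (Polynomial.X : R[X]) • c t (i + 1) := by
    intro t i
    induction t with
    | zero => simp
    | add x y hx hy =>
      simp only [map_add, Finsupp.add_apply, hx, hy, smul_add]
      abel
    | tmul p m =>
      have hr : ∀ (p : R[X]) (i : ℕ), (Polynomial.basisMonomials R).repr p i = p.coeff i :=
        fun _ _ => rfl
      rw [xSubX_tmul, map_sub]
      simp only [c, Finsupp.sub_apply, TensorProduct.equivFinsuppOfBasisLeft_apply_tmul_apply, hr,
        Polynomial.coeff_X_mul]
      rw [smul_comm (p.coeff (i + 1)) (Polynomial.X : R[X]) m]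
  rw [injective_iff_map_eq_zero]
  intro t ht
  have h0 : ∀ i, c t (i + 1) = 0 → c t i = 0 := by
    intro i hi
    have := hc t i
    rwa [ht, hi, smul_zero, sub_zero, map_zero, Finsupp.zero_apply, eq_comm] at this
  obtain ⟨N, hN⟩ : ∃ N, ∀ i, N ≤ i → c t i = 0 := by
    refine ⟨(c t).support.sup id + 1, fun i hi => ?_⟩
    by_contra h
    have := Finset.le_sup (f := id) (Finsupp.mem_support_iff.2 h)
    simp only [id] at this
    omega
  have h1 : ∀ k i, N ≤ i + k → c t i = 0 := by
    intro k
    induction k with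
    | zero => exact hN
    | succ k ih => exact fun i hi => h0 i (ih _ (by omega))
  refine c.injective ?_
  ext1 i
  rw [map_zero]
  exact h1 N i (by omega)

theorem _root_.ProjDimLT.of_polynomial_restrict {n : ℕ} (h : ProjDimLT R (n + 1) M) :
    ProjDimLT R[X] (n + 2) M := by
  have hT := ProjDimLT.polynomial_tensor M h
  refine ProjDimLT.right (f := xSubX (R := R) M) (g := actionMap M) xSubX_injective ?_ ?_ hT
    (hT.mono (by omega))
  · intro t
    constructor
    · intro ht
      obtain ⟨s, hs⟩ := exists_eq_xSubX_add t
      rw [ht, TensorProduct.tmul_zero, add_zero] at hs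
      exact ⟨s, hs.symm⟩
    · rintro ⟨s, rfl⟩
      exact actionMap_xSubX s
  · exact fun m => ⟨1 ⊗ₜ m, by rw [actionMap_tmul, one_smul]⟩

theorem polynomial {n : ℕ} (h : GlDimLT R (n + 1)) : GlDimLT R[X] (n + 2) := by
  intro M _ _
  let : Module R M := Module.compHom M (Polynomial.C : R →+* R[X])
  have : IsScalarTower R R[X] M := ⟨fun r p m => by
    rw [Polynomial.smul_eq_C_mul, mul_smul]; rfl⟩
  exact ProjDimLT.of_polynomial_restrict (h M)

end Polynomial

theorem mvPolynomial (K : Type) [Field K] (n : ℕ) :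
    GlDimLT (MvPolynomial (Fin n) K) (n + 1) := by
  induction n with
  | zero => exact (of_field K).of_ringEquiv (isEmptyRingEquiv K (Fin 0)).symm
  | succ n ih => exact (polynomial ih).of_ringEquiv (finSuccEquiv K n).symm.toRingEquiv

end GlDimLT

section ColMod

variable {Λ S ι : Type} [Ring Λ] [CommRing S] [Fintype ι] [DecidableEq ι]
  (ρ : Λ →+* Matrix ι ι S)

/-- Columns with entries in `V`, on which `Λ` acts by matrices over `S`. -/
@[nolint unusedArguments]
def ColMod (_ρ : Λ →+* Matrix ι ι S) (V : Type) : Type := ι → V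

namespace ColMod

variable {ρ} in
@[ext] theorem ext {V : Type} {v w : ColMod ρ V} (h : ∀ q, v q = w q) : v = w := funext h

variable (V W : Type) [AddCommGroup V] [AddCommGroup W]

noncomputable instance : AddCommGroup (ColMod ρ V) := inferInstanceAs (AddCommGroup (ι → V))

variable {V} in
theorem add_apply (v w : ColMod ρ V) (q : ι) : (v + w) q = v q + w q := rfl

theorem zero_apply (q : ι) : (0 : ColMod ρ V) q = 0 := rfl

variable [Module S V] [Module S W]

noncomputable instance : Module S (ColMod ρ V) := inferInstanceAs (Module S (ι → V))

noncomputable instance : SMul Λ (ColMod ρ V) := ⟨fun l v q => ∑ p, ρ l q p • v p⟩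

variable {V W}

theorem smul_apply (l : Λ) (v : ColMod ρ V) (q : ι) : (l • v) q = ∑ p, ρ l q p • v p := rfl

theorem base_smul_apply (s : S) (v : ColMod ρ V) (q : ι) : (s • v) q = s • v q := rfl

noncomputable instance : Module Λ (ColMod ρ V) where
  one_smul v := by
    ext q
    simp only [smul_apply, map_one, Matrix.one_apply, ite_smul, one_smul, zero_smul]
    exact (Finset.sum_ite_eq _ _ _).trans (by simp)
  mul_smul l m v := by
    ext q
    simp only [smul_apply, map_mul, Matrix.mul_apply, Finset.sum_smul, Finset.smul_sum, mul_smul]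
    exact Finset.sum_comm
  smul_zero l := by ext q; simp [smul_apply, zero_apply]
  smul_add l v w := by ext q; simp [smul_apply, add_apply, smul_add, Finset.sum_add_distrib]
  add_smul l m v := by ext q; simp [smul_apply, add_apply, add_smul, Finset.sum_add_distrib]
  zero_smul v := by ext q; simp [smul_apply, zero_apply]

instance : SMulCommClass Λ S (ColMod ρ V) := ⟨fun l s v => by
  ext q
  simp only [smul_apply, base_smul_apply, Finset.smul_sum]
  exact Finset.sum_congr rfl fun p _ => smul_comm _ _ _⟩

variable {ρ}

/-- `ColMod` is functorial in the coefficient module. -/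
def map (f : V →ₗ[S] W) : ColMod ρ V →ₗ[Λ] ColMod ρ W where
  toFun v q := f (v q)
  map_add' v w := by ext q; exact map_add f _ _
  map_smul' l v := by
    ext q
    change f (∑ p, ρ l q p • v p) = ∑ p, ρ l q p • f (v p)
    simp only [map_sum, map_smul]

theorem map_apply (f : V →ₗ[S] W) (v : ColMod ρ V) (q : ι) : map f v q = f (v q) := rfl

theorem map_injective {f : V →ₗ[S] W} (hf : Function.Injective f) :
    Function.Injective (map (ρ := ρ) f) :=
  fun _ _ h => ext fun q => hf (congrFun h q)

theorem map_surjective {f : V →ₗ[S] W} (hf : Function.Surjective f) :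
    Function.Surjective (map (ρ := ρ) f) := fun w =>
  ⟨fun q => (hf (w q)).choose, ext fun q => (hf (w q)).choose_spec⟩

theorem map_exact {U : Type} [AddCommGroup U] [Module S U] {f : U →ₗ[S] V} {g : V →ₗ[S] W}
    (h : Function.Exact f g) : Function.Exact (map (ρ := ρ) f) (map (ρ := ρ) g) := by
  intro v
  constructor
  · intro hv
    have : ∀ q, ∃ u, f u = v q := fun q => (h _).1 (congrFun hv q)
    choose u hu using this
    exact ⟨u, ext hu⟩
  · rintro ⟨u, rfl⟩
    exact ext fun q => h.apply_apply_eq_zero (u q)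

variable (ρ) in
/-- `ColMod` commutes with direct sums. -/
noncomputable def finsuppToCol (J : Type) : (J →₀ ColMod ρ V) →ₗ[Λ] ColMod ρ (J →₀ V) :=
  Finsupp.lsum ℕ fun j => map (Finsupp.lsingle j)

theorem finsuppToCol_apply (J : Type) (x : J →₀ ColMod ρ V) (q : ι) (j : J) :
    finsuppToCol ρ J x q j = x j q := by
  classical
  induction x using Finsupp.induction_linear with
  | zero => simp [zero_apply]
  | add x y hx hy => simp [add_apply, hx, hy]
  | single i v =>
    rw [finsuppToCol, Finsupp.lsum_single, map_apply, Finsupp.lsingle_apply,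
      Finsupp.single_apply, Finsupp.single_apply]
    split_ifs <;> rfl

theorem finsuppToCol_bijective (J : Type) :
    Function.Bijective (finsuppToCol (V := V) ρ J) := by
  classical
  constructor
  · intro x y h
    ext j q
    rw [← finsuppToCol_apply, h, finsuppToCol_apply]
  · intro v
    refine ⟨Finsupp.onFinset (Finset.univ.biUnion fun q => (v q).support)
      (fun j => (fun q => v q j : ι → V)) ?_, ?_⟩
    · intro j hj
      by_contra h
      apply hj
      ext q
      by_contra h'
      exact h (Finset.mem_biUnion.2 ⟨q, Finset.mem_univ q, Finsupp.mem_support_iff.2 h'⟩)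
    · ext q j
      rw [finsuppToCol_apply]
      rfl

theorem projDimLT_finsupp (J : Type) {n : ℕ} (h : ProjDimLT Λ (n + 1) (ColMod ρ V)) :
    ProjDimLT Λ (n + 1) (ColMod ρ (J →₀ V)) :=
  (h.finsupp J).of_linearEquiv (LinearEquiv.ofBijective _ (finsuppToCol_bijective J))

theorem projDimLT {i j : ℕ} (hS : ProjDimLT Λ (j + 1) (ColMod ρ S))
    (hV : ProjDimLT S (i + 1) V) : ProjDimLT Λ (i + j + 1) (ColMod ρ V) := by
  induction i generalizing V with
  | zero =>
    have := ProjDimLT.one_iff.1 hV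
    obtain ⟨s, hs⟩ := Module.projective_def'.1 this
    exact ((projDimLT_finsupp V hS).mono (by omega)).of_retract (map s)
      (map (Finsupp.linearCombination S id)) fun v => ext fun q => LinearMap.congr_fun hs (v q)
  | succ i ih =>
    have hs := Finsupp.linearCombination_id_surjective S V
    have hK := ih (ProjDimLT.ker_of_surjective hs (ProjDimLT.of_projective (by omega)) hV)
    have hF : ProjDimLT Λ (i + j + 1 + 1) (ColMod ρ (V →₀ S)) :=
      (projDimLT_finsupp V hS).mono (by omega)
    rw [show i + 1 + j + 1 = i + j + 1 + 1 by omega]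
    exact ProjDimLT.right (map_injective (Submodule.injective_subtype _))
      (map_exact (LinearMap.exact_subtype_ker_map _)) (map_surjective hs) hK hF

end ColMod

end ColMod

section Graded

variable {K D : Type} [Field K] [AddCommGroup D] {σ : Type} (w : σ → D)

theorem weightedHomogeneousComponent_mul_left [DecidableEq D] {s : MvPolynomial σ K} {d : D}
    (hs : IsWeightedHomogeneous w s d) (v : MvPolynomial σ K) (e : D) :
    weightedHomogeneousComponent w (d + e) (s * v) =
      s * weightedHomogeneousComponent w e v := by
  induction v using MvPolynomial.induction_on' with
  | monomial m c =>
    have hm := isWeightedHomogeneous_monomial w m c rfl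
    by_cases h : e = Finsupp.weight w m
    · subst h
      rw [hm.weightedHomogeneousComponent_same, (hs.mul hm).weightedHomogeneousComponent_same]
    · rw [hm.weightedHomogeneousComponent_ne e h, mul_zero,
        (hs.mul hm).weightedHomogeneousComponent_ne _ fun h' => h (add_left_cancel h')]
  | add p q hp hq => rw [mul_add, map_add, hp, hq, map_add, mul_add]

variable {ι Λ : Type} [Ring Λ] [Fintype ι] [DecidableEq ι]

/-- `ρ` identifies `Λ` with the ring of matrices whose `(q, p)` entry is homogeneous of degree
`δ q - δ p`. -/
structure IsGradedMatrixRing (δ : ι → D) (ρ : Λ →+* Matrix ι ι (MvPolynomial σ K)) : Prop where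
  injective : Function.Injective ρ
  homogeneous : ∀ l q p, IsWeightedHomogeneous w (ρ l q p) (δ q - δ p)
  exists_eq : ∀ A : Matrix ι ι (MvPolynomial σ K),
    (∀ q p, IsWeightedHomogeneous w (A q p) (δ q - δ p)) → ∃ l, ρ l = A

namespace IsGradedMatrixRing

variable {w} {δ : ι → D} {ρ : Λ →+* Matrix ι ι (MvPolynomial σ K)}

theorem ext (h : IsGradedMatrixRing w δ ρ) {l m : Λ} (hlm : ∀ q p, ρ l q p = ρ m q p) : l = m :=
  h.injective (Matrix.ext hlm)

theorem exists_column (h : IsGradedMatrixRing w δ ρ) (q : ι)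
    (v : ColMod ρ (MvPolynomial σ K)) : ∃ l, ∀ s p, ρ l s p =
    if p = q then weightedHomogeneousComponent w (δ s - δ p) (v s) else 0 := by
  obtain ⟨l, hl⟩ := h.exists_eq (Matrix.of fun s p =>
    if p = q then weightedHomogeneousComponent w (δ s - δ p) (v s) else 0) fun s p => by
      rw [Matrix.of_apply]
      split_ifs
      · exact weightedHomogeneousComponent_isWeightedHomogeneous (w := w) (δ s - δ p) (v s)
      · exact isWeightedHomogeneous_zero K w _
  exact ⟨l, fun s p => by rw [hl, Matrix.of_apply]⟩

/-- The element of `Λ` whose only nonzero column is the `q`-th one, built from the components of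
`v` of the appropriate degrees. -/
noncomputable def column (h : IsGradedMatrixRing w δ ρ) (q : ι)
    (v : ColMod ρ (MvPolynomial σ K)) : Λ :=
  (h.exists_column q v).choose

variable (h : IsGradedMatrixRing w δ ρ)

theorem map_column (q : ι) (v : ColMod ρ (MvPolynomial σ K)) (s p : ι) :
    ρ (h.column q v) s p =
      if p = q then weightedHomogeneousComponent w (δ s - δ p) (v s) else 0 :=
  (h.exists_column q v).choose_spec s p

theorem column_add (q : ι) (u v : ColMod ρ (MvPolynomial σ K)) :
    h.column q (u + v) = h.column q u + h.column q v := by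
  refine h.ext fun s p => ?_
  rw [map_add, Matrix.add_apply, map_column, map_column, map_column]
  split_ifs
  · exact map_add _ _ _
  · simp

/-- The columns of the identity matrix. -/
noncomputable def stdCol (ρ : Λ →+* Matrix ι ι (MvPolynomial σ K)) (q : ι) :
    ColMod ρ (MvPolynomial σ K) :=
  fun p => if p = q then 1 else 0

theorem sum_column_stdCol : ∑ q, h.column q (stdCol ρ q) = 1 := by
  refine h.ext fun s p => ?_
  rw [map_sum, Matrix.sum_apply]
  simp only [map_column, Finset.sum_ite_eq, Finset.mem_univ, if_true, map_one, Matrix.one_apply,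
    stdCol]
  split_ifs with hsp
  · subst hsp
    rw [sub_self]
    exact (isWeightedHomogeneous_one K w).weightedHomogeneousComponent_same
  · simp

variable [DecidableEq D]

theorem column_smul (q : ι) (l : Λ) (v : ColMod ρ (MvPolynomial σ K)) :
    h.column q (l • v) = l * h.column q v := by
  refine h.ext fun s p => ?_
  simp only [map_mul, Matrix.mul_apply, map_column]
  split_ifs
  · rw [ColMod.smul_apply, map_sum]
    refine Finset.sum_congr rfl fun t _ => ?_
    rw [smul_eq_mul, ← weightedHomogeneousComponent_mul_left w (h.homogeneous l s t),
      sub_add_sub_cancel]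
  · simp

theorem column_mul (q : ι) (l : Λ) (v : ColMod ρ (MvPolynomial σ K)) :
    h.column q v * l = ∑ p, h.column p (ρ l q p • v) := by
  refine h.ext fun s p => ?_
  rw [map_sum, Matrix.sum_apply]
  simp only [map_mul, Matrix.mul_apply, map_column, Finset.sum_ite_eq, Finset.mem_univ, if_true,
    ite_mul, zero_mul, Finset.sum_ite_eq']
  rw [ColMod.base_smul_apply, smul_eq_mul, mul_comm,
    ← weightedHomogeneousComponent_mul_left w (h.homogeneous l q p), add_comm, sub_add_sub_cancel]

variable {M : Type} [AddCommGroup M] [Module Λ M]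

variable (ρ M) in
/-- The base ring acts on homomorphisms out of `ColMod ρ S` through the source. -/
noncomputable abbrev homModule :
    Module (MvPolynomial σ K) (ColMod ρ (MvPolynomial σ K) →ₗ[Λ] M) where
  smul s f := f ∘ₗ
    { toFun := fun v => s • v
      map_add' := smul_add s
      map_smul' := fun l v => (smul_comm l s v).symm }
  one_smul f := by ext v; exact congrArg f (one_smul _ v)
  mul_smul s t f := by
    ext v; exact congrArg f ((congrArg (· • v) (mul_comm s t)).trans (mul_smul t s v))
  smul_zero s := by ext v; rfl
  smul_add s f f' := by ext v; rfl
  add_smul s t f := by ext v; exact (congrArg f (add_smul s t v)).trans (map_add f _ _)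
  zero_smul f := by ext v; exact (congrArg f (zero_smul _ v)).trans (map_zero f)

attribute [local instance] homModule

theorem sum_smul_stdCol (l : Λ) (p : ι) : ∑ q, ρ l q p • stdCol ρ q = l • stdCol ρ p := by
  ext s : 1
  rw [ColMod.smul_apply]
  refine (Finset.sum_apply s Finset.univ fun q => ρ l q p • stdCol ρ q).trans ?_
  simp [ColMod.base_smul_apply, stdCol]

theorem colMod_homModule_smul_apply (l : Λ)
    (f : ColMod ρ (ColMod ρ (MvPolynomial σ K) →ₗ[Λ] M)) (q : ι)
    (v : ColMod ρ (MvPolynomial σ K)) : (l • f) q v = ∑ p, f p (ρ l q p • v) := by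
  rw [ColMod.smul_apply, LinearMap.sum_apply]
  rfl

variable (ρ M) in
/-- Evaluation at the standard columns. -/
noncomputable def evalStd :
    ColMod ρ (ColMod ρ (MvPolynomial σ K) →ₗ[Λ] M) →ₗ[Λ] M where
  toFun f := ∑ q, f q (stdCol ρ q)
  map_add' f f' := by
    rw [← Finset.sum_add_distrib]
    rfl
  map_smul' l f := by
    simp only [colMod_homModule_smul_apply, RingHom.id_apply, Finset.smul_sum]
    rw [Finset.sum_comm]
    refine Finset.sum_congr rfl fun p _ => ?_
    rw [← map_sum, sum_smul_stdCol, map_smul]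

/-- The section of `evalStd`. -/
noncomputable def toHom (h : IsGradedMatrixRing w δ ρ) (M : Type) [AddCommGroup M] [Module Λ M] :
    M →ₗ[Λ] ColMod ρ (ColMod ρ (MvPolynomial σ K) →ₗ[Λ] M) where
  toFun m q :=
    { toFun := fun v => h.column q v • m
      map_add' := fun u v => by rw [column_add, add_smul]
      map_smul' := fun l v => by rw [column_smul, mul_smul]; rfl }
  map_add' m m' := by ext q v; exact smul_add _ _ _
  map_smul' l m := by
    ext q v
    refine Eq.trans ?_ (colMod_homModule_smul_apply l _ q v).symm
    change h.column q v • l • m = ∑ p, h.column p (ρ l q p • v) • m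
    rw [← Finset.sum_smul, ← column_mul, mul_smul]

theorem evalStd_toHom (m : M) : evalStd ρ M (h.toHom M m) = m := by
  change ∑ q, h.column q (stdCol ρ q) • m = m
  rw [← Finset.sum_smul, sum_column_stdCol, one_smul]

theorem glDimLT {i j : ℕ} (h : IsGradedMatrixRing w δ ρ) (hS : GlDimLT (MvPolynomial σ K) (i + 1))
    (hC : ProjDimLT Λ (j + 1) (ColMod ρ (MvPolynomial σ K))) : GlDimLT Λ (i + j + 1) :=
  fun M _ _ => (ColMod.projDimLT hC (hS _)).of_retract (h.toHom M) (evalStd ρ M) h.evalStd_toHom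

end IsGradedMatrixRing

end Graded

section AtDegree

variable {D σ : Type} [DecidableEq D]

/-- The family of upper sets concentrated in one degree. -/
def atDegree (d : D) (U : UpperSet (σ →₀ ℕ)) (e : D) : UpperSet (σ →₀ ℕ) := if e = d then U else ⊤

theorem mem_atDegree {d e : D} {U : UpperSet (σ →₀ ℕ)} {m : σ →₀ ℕ} :
    m ∈ atDegree d U e ↔ e = d ∧ m ∈ U := by
  rw [atDegree]
  split_ifs with he <;> simp [he]

theorem atDegree_sup (d : D) (U V : UpperSet (σ →₀ ℕ)) :
    atDegree d (U ⊔ V) = atDegree d U ⊔ atDegree d V := by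
  ext e m
  simp only [SetLike.mem_coe, Pi.sup_apply, UpperSet.mem_sup_iff, mem_atDegree]
  tauto

theorem atDegree_inf (d : D) (U V : UpperSet (σ →₀ ℕ)) :
    atDegree d (U ⊓ V) = atDegree d U ⊓ atDegree d V := by
  ext e m
  simp only [SetLike.mem_coe, Pi.inf_apply, UpperSet.mem_inf_iff, mem_atDegree]
  tauto

end AtDegree

section MonomialSubmodule

variable {K D : Type} [Field K] [AddCommGroup D] {σ : Type} {w : σ → D}
  {ι Λ : Type} [Ring Λ] [Fintype ι] [DecidableEq ι] {δ : ι → D}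
  {ρ : Λ →+* Matrix ι ι (MvPolynomial σ K)}

namespace IsGradedMatrixRing

/-- The submodule of columns spanned by the monomials in position `q` and of exponent `m`, for
`m` in the upper set attached to the degree `δ q - weight m`. -/
noncomputable def monomialSubmodule (h : IsGradedMatrixRing w δ ρ) (W : D → UpperSet (σ →₀ ℕ)) :
    Submodule Λ (ColMod ρ (MvPolynomial σ K)) where
  carrier := {v | ∀ q m, coeff m (v q) ≠ 0 → m ∈ W (δ q - Finsupp.weight w m)}
  zero_mem' q m hm := absurd (coeff_zero m) hm
  add_mem' {u v} hu hv q m hm := by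
    rw [ColMod.add_apply, coeff_add] at hm
    by_cases h0 : coeff m (u q) = 0
    · exact hv q m fun h1 => hm (by rw [h0, h1, add_zero])
    · exact hu q m h0
  smul_mem' l v hv q m hm := by
    classical
    rw [ColMod.smul_apply, coeff_sum] at hm
    obtain ⟨p, -, hp⟩ := Finset.exists_ne_zero_of_sum_ne_zero hm
    rw [smul_eq_mul, coeff_mul] at hp
    obtain ⟨⟨a, b⟩, hab, hne⟩ := Finset.exists_ne_zero_of_sum_ne_zero hp
    rw [Finset.HasAntidiagonal.mem_antidiagonal] at hab
    have hb := hv p b (right_ne_zero_of_mul hne)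
    have ha := h.homogeneous l q p (left_ne_zero_of_mul hne)
    dsimp only at hab
    subst hab
    rw [map_add, ha, show δ q - (δ q - δ p + Finsupp.weight w b) = δ p - Finsupp.weight w b by abel]
    exact (W _).upper le_add_self hb

variable (h : IsGradedMatrixRing w δ ρ)

theorem mem_monomialSubmodule {W : D → UpperSet (σ →₀ ℕ)} {v : ColMod ρ (MvPolynomial σ K)} :
    v ∈ h.monomialSubmodule W ↔
      ∀ q m, coeff m (v q) ≠ 0 → m ∈ W (δ q - Finsupp.weight w m) := Iff.rfl

theorem monomialSubmodule_sup (W W' : D → UpperSet (σ →₀ ℕ)) :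
    h.monomialSubmodule (W ⊔ W') = h.monomialSubmodule W ⊓ h.monomialSubmodule W' := by
  ext v
  simp only [Submodule.mem_inf, mem_monomialSubmodule, Pi.sup_apply, UpperSet.mem_sup_iff]
  exact ⟨fun hv => ⟨fun q m hm => (hv q m hm).1, fun q m hm => (hv q m hm).2⟩,
    fun hv q m hm => ⟨hv.1 q m hm, hv.2 q m hm⟩⟩

theorem monomialSubmodule_inf (W W' : D → UpperSet (σ →₀ ℕ)) :
    h.monomialSubmodule (W ⊓ W') = h.monomialSubmodule W ⊔ h.monomialSubmodule W' := by
  classical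
  refine le_antisymm (fun v hv => ?_) (sup_le ?_ ?_)
  · let u : ColMod ρ (MvPolynomial σ K) := fun q =>
      ∑ m ∈ (v q).support with m ∈ W (δ q - Finsupp.weight w m), monomial m (coeff m (v q))
    have hu : ∀ q m, coeff m (u q) =
        if m ∈ W (δ q - Finsupp.weight w m) then coeff m (v q) else 0 := by
      intro q m
      change coeff m (∑ _ ∈ _, _) = _
      simp only [coeff_sum, coeff_monomial, Finset.sum_ite_eq', Finset.mem_filter, mem_support_iff]
      split_ifs <;> simp_all
    refine Submodule.mem_sup.2 ⟨u, fun q m hm => ?_, v - u, fun q m hm => ?_, add_sub_cancel _ _⟩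
    · rw [hu] at hm
      by_contra h'
      exact hm (if_neg h')
    · change coeff m (v q - u q) ≠ 0 at hm
      rw [coeff_sub, hu] at hm
      split_ifs at hm with h'
      · exact absurd (sub_self _) hm
      · exact (UpperSet.mem_inf_iff.1 (hv q m (by simpa using hm))).resolve_left h'
  · exact fun v hv q m hm => UpperSet.mem_inf_iff.2 (Or.inl (hv q m hm))
  · exact fun v hv q m hm => UpperSet.mem_inf_iff.2 (Or.inr (hv q m hm))

theorem monomialSubmodule_bot : h.monomialSubmodule ⊥ = ⊤ :=
  eq_top_iff.2 fun _ _ _ _ _ => UpperSet.mem_bot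

theorem monomialSubmodule_top : h.monomialSubmodule ⊤ = ⊥ := by
  refine eq_bot_iff.2 fun v hv => (Submodule.mem_bot Λ).2 ?_
  ext q m
  by_contra hm
  exact UpperSet.notMem_top (hv q m hm)

/-- The monomial column of exponent `g` in position `t`. -/
noncomputable def monomialCol (_h : IsGradedMatrixRing w δ ρ) (t : ι) (g : σ →₀ ℕ) :
    ColMod ρ (MvPolynomial σ K) := fun p => if p = t then monomial g 1 else 0

/-- Entrywise division by the monomial of exponent `g`. -/
noncomputable def divCol (v : ColMod ρ (MvPolynomial σ K)) (g : σ →₀ ℕ) :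
    ColMod ρ (MvPolynomial σ K) := fun q => divMonomial (v q) g

theorem divCol_apply (v : ColMod ρ (MvPolynomial σ K)) (g : σ →₀ ℕ) (q : ι) :
    divCol v g q = divMonomial (v q) g := rfl

theorem smul_monomialCol_apply (l : Λ) (t : ι) (g : σ →₀ ℕ) (q : ι) :
    (l • h.monomialCol t g) q = ρ l q t * monomial g 1 := by
  simp [ColMod.smul_apply, monomialCol]

theorem monomialCol_mem {W : D → UpperSet (σ →₀ ℕ)} {t : ι} {g : σ →₀ ℕ}
    (hg : g ∈ W (δ t - Finsupp.weight w g)) : h.monomialCol t g ∈ h.monomialSubmodule W := by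
  classical
  intro q m hm
  rw [monomialCol] at hm
  split_ifs at hm with hq
  · rw [coeff_monomial] at hm
    obtain rfl : g = m := by by_contra hgm; exact hm (if_neg hgm)
    rwa [hq]
  · exact absurd (coeff_zero m) hm

variable [DecidableEq D]

/-- The part of `monomialSubmodule` in a single degree. -/
noncomputable abbrev degreeSubmodule (d : D) (U : UpperSet (σ →₀ ℕ)) :
    Submodule Λ (ColMod ρ (MvPolynomial σ K)) :=
  h.monomialSubmodule (atDegree d U)

theorem mem_degreeSubmodule {d : D} {U : UpperSet (σ →₀ ℕ)}
    {v : ColMod ρ (MvPolynomial σ K)} : v ∈ h.degreeSubmodule d U ↔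
      ∀ q m, coeff m (v q) ≠ 0 → δ q - Finsupp.weight w m = d ∧ m ∈ U := by
  simp only [degreeSubmodule, mem_monomialSubmodule, mem_atDegree]

theorem degreeSubmodule_sup (d : D) (U V : UpperSet (σ →₀ ℕ)) :
    h.degreeSubmodule d (U ⊔ V) = h.degreeSubmodule d U ⊓ h.degreeSubmodule d V := by
  rw [degreeSubmodule, atDegree_sup, monomialSubmodule_sup]

theorem degreeSubmodule_inf (d : D) (U V : UpperSet (σ →₀ ℕ)) :
    h.degreeSubmodule d (U ⊓ V) = h.degreeSubmodule d U ⊔ h.degreeSubmodule d V := by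
  rw [degreeSubmodule, atDegree_inf, monomialSubmodule_inf]

theorem projDimLT_colMod [Fintype D] {n : ℕ}
    (hd : ∀ d, ProjDimLT Λ (n + 1) (h.degreeSubmodule d ⊥)) :
    ProjDimLT Λ (n + 1) (ColMod ρ (MvPolynomial σ K)) := by
  have key : ∀ F : Finset D, ProjDimLT Λ (n + 1)
      (h.monomialSubmodule fun e => if e ∈ F then ⊥ else ⊤) := by
    intro F
    have hbot : ∀ k, ProjDimLT Λ k (h.monomialSubmodule ⊤) := fun k => by
      rw [h.monomialSubmodule_top]
      exact ProjDimLT.of_subsingleton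
    induction F using Finset.induction_on with
    | empty => exact hbot (n + 1)
    | insert d F hdF ih =>
      have h1 : (fun e => if e ∈ insert d F then (⊥ : UpperSet (σ →₀ ℕ)) else ⊤) =
          (fun e => if e ∈ F then ⊥ else ⊤) ⊓ atDegree d ⊥ := by
        ext e m
        simp only [SetLike.mem_coe, Pi.inf_apply, UpperSet.mem_inf_iff, mem_atDegree,
          Finset.mem_insert]
        by_cases h1 : e = d <;> by_cases h2 : e ∈ F <;> simp [h1, h2]
      have h2 : (fun e => if e ∈ F then (⊥ : UpperSet (σ →₀ ℕ)) else ⊤) ⊔ atDegree d ⊥ = ⊤ := by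
        ext e m
        simp only [SetLike.mem_coe, Pi.sup_apply, UpperSet.mem_sup_iff, mem_atDegree]
        by_cases h1 : e = d
        · subst h1; simp [hdF]
        · simp [h1]
      rw [h1, monomialSubmodule_inf]
      refine ProjDimLT.sup ?_ ih (hd d)
      rw [← monomialSubmodule_sup, h2]
      exact hbot n
  have := key Finset.univ
  rw [show (fun e : D => if e ∈ Finset.univ then (⊥ : UpperSet (σ →₀ ℕ)) else ⊤) = ⊥ by
    ext e m; simp, monomialSubmodule_bot] at this
  exact this.of_linearEquiv Submodule.topEquiv

theorem monomial_mul_divMonomial {U : UpperSet (σ →₀ ℕ)} {g : σ →₀ ℕ} (hU : UpperSet.Ici g ≤ U)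
    {d : D} {v : ColMod ρ (MvPolynomial σ K)} (hv : v ∈ h.degreeSubmodule d U) (q : ι) :
    monomial g 1 * (v q).divMonomial g = v q := by
  conv_rhs => rw [← divMonomial_add_modMonomial (v q) g]
  rw [left_eq_add]
  ext m
  rw [coeff_zero]
  by_cases hm : g ≤ m
  · rw [coeff_modMonomial_of_le _ hm]
  · rw [coeff_modMonomial_of_not_le _ hm]
    by_contra hne
    exact hm (hU (h.mem_degreeSubmodule.1 hv q m hne).2)

theorem projective_degreeSubmodule_Ici (t : ι) (g : σ →₀ ℕ) :
    Module.Projective Λ (h.degreeSubmodule (δ t - Finsupp.weight w g) (UpperSet.Ici g)) := by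
  set d := δ t - Finsupp.weight w g with hd
  have hdiv : ∀ v ∈ h.degreeSubmodule d (UpperSet.Ici g), ∀ q,
      monomial g 1 * (v q).divMonomial g = v q := fun v hv => h.monomial_mul_divMonomial le_rfl hv
  let f : Λ →ₗ[Λ] h.degreeSubmodule d (UpperSet.Ici g) := LinearMap.toSpanSingleton Λ _
    ⟨h.monomialCol t g, h.monomialCol_mem (mem_atDegree.2 ⟨hd.symm, UpperSet.mem_Ici_iff.2 le_rfl⟩)⟩
  let s : h.degreeSubmodule d (UpperSet.Ici g) →ₗ[Λ] Λ :=
    { toFun := fun v => h.column t (divCol v.1 g)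
      map_add' := fun u v => by
        rw [← column_add]
        congr 1
        ext q : 1
        exact add_divMonomial _ _ _
      map_smul' := fun l v => by
        rw [RingHom.id_apply, smul_eq_mul, ← column_smul]
        congr 1
        ext q : 1
        change divMonomial (∑ p, ρ l q p • v.1 p) g = ∑ p, ρ l q p • (v.1 p).divMonomial g
        conv_lhs =>
          enter [1, 2, p]
          rw [← hdiv v.1 v.2 p, smul_eq_mul, mul_left_comm]
        rw [← Finset.mul_sum, divMonomial_monomial_mul]
        simp only [smul_eq_mul] }
  refine Module.Projective.of_split s f (LinearMap.ext fun v => Subtype.ext ?_)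
  ext q : 1
  change (h.column t (divCol v.1 g) • h.monomialCol t g) q = v.1 q
  rw [smul_monomialCol_apply, map_column, if_pos rfl, mul_comm, divCol_apply]
  conv_rhs => rw [← hdiv v.1 v.2 q]
  congr 1
  refine weightedHomogeneousComponent_eq_self fun m hm => ?_
  rw [coeff_divMonomial] at hm
  have := (h.mem_degreeSubmodule.1 v.2 q _ hm).1
  rw [map_add, hd] at this
  have h' : δ q - Finsupp.weight w m = δ t := by
    rw [← sub_left_inj (a := Finsupp.weight w g), ← this]; abel
  rw [← h', sub_sub_cancel]

end IsGradedMatrixRing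

end MonomialSubmodule

section Staircase

/-- The exponent of the monomial `x ^ c * y ^ b`. -/
noncomputable def expPair (c b : ℕ) : Fin 2 →₀ ℕ := Finsupp.single 0 c + Finsupp.single 1 b

@[simp] theorem expPair_zero (c b : ℕ) : expPair c b 0 = c := by simp [expPair]

@[simp] theorem expPair_one (c b : ℕ) : expPair c b 1 = b := by simp [expPair]

theorem eq_expPair (m : Fin 2 →₀ ℕ) : m = expPair (m 0) (m 1) := by
  ext i
  fin_cases i <;> simp

theorem expPair_le_iff {c b : ℕ} {m : Fin 2 →₀ ℕ} : expPair c b ≤ m ↔ c ≤ m 0 ∧ b ≤ m 1 := by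
  rw [Finsupp.le_def, Fin.forall_fin_two, expPair_zero, expPair_one]

theorem weight_expPair {D : Type} [AddCommGroup D] (w : Fin 2 → D) (c b : ℕ) :
    Finsupp.weight w (expPair c b) = c • w 0 + b • w 1 := by
  simp [expPair, Finsupp.weight_single]

variable {K D : Type} [Field K] [AddCommGroup D] {w : Fin 2 → D}
  {ι Λ : Type} [Ring Λ] [Fintype ι] [DecidableEq ι] {δ : ι → D}
  {ρ : Λ →+* Matrix ι ι (MvPolynomial (Fin 2) K)}

namespace IsGradedMatrixRing

/-- The upper set generated by the exponents `(c, β)` with `β ≤ b` of degree in `T`. -/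
def staircase (T : Set D) (w : Fin 2 → D) (d : D) (b : ℕ) : UpperSet (Fin 2 →₀ ℕ) where
  carrier := {m | ∃ c β, β ≤ b ∧ d + (c • w 0 + β • w 1) ∈ T ∧ c ≤ m 0 ∧ β ≤ m 1}
  upper' := by
    rintro m m' hm ⟨c, β, hβ, hs, h0, h1⟩
    exact ⟨c, β, hβ, hs, h0.trans (hm 0), h1.trans (hm 1)⟩

theorem mem_staircase {T : Set D} {d : D} {b : ℕ} {m : Fin 2 →₀ ℕ} :
    m ∈ staircase T w d b ↔
      ∃ c β, β ≤ b ∧ d + (c • w 0 + β • w 1) ∈ T ∧ c ≤ m 0 ∧ β ≤ m 1 := Iff.rfl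

theorem mem_Ici_expPair {c b : ℕ} {m : Fin 2 →₀ ℕ} :
    m ∈ UpperSet.Ici (expPair c b) ↔ c ≤ m 0 ∧ b ≤ m 1 :=
  UpperSet.mem_Ici_iff.trans expPair_le_iff

/-- Special lattice points are closed under filling in the corner of an empty rectangle. -/
def CornerClosed (w : Fin 2 → D) (T : Set D) : Prop :=
  ∀ (e : D) (c b : ℕ), e + c • w 0 ∈ T → e + b • w 1 ∈ T →
    (∀ x < c, ∀ y < b, e + (x • w 0 + y • w 1) ∉ T) → e + (c • w 0 + b • w 1) ∈ T

theorem CornerClosed.apply {T : Set D} (hT : CornerClosed w T) {d : D} {c₁ b₁ c₂ b₂ : ℕ}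
    (hc : c₂ ≤ c₁) (hb : b₁ ≤ b₂) (h₁ : d + (c₁ • w 0 + b₁ • w 1) ∈ T)
    (h₂ : d + (c₂ • w 0 + b₂ • w 1) ∈ T)
    (hbox : ∀ c b, c < c₁ → b < b₂ → d + (c • w 0 + b • w 1) ∉ T) :
    d + (c₁ • w 0 + b₂ • w 1) ∈ T := by
  obtain ⟨c, rfl⟩ := Nat.exists_eq_add_of_le hc
  obtain ⟨b, rfl⟩ := Nat.exists_eq_add_of_le hb
  have := hT (d + (c₂ • w 0 + b₁ • w 1)) c b
    (by convert h₁ using 1; rw [add_smul]; abel) (by convert h₂ using 1; rw [add_smul]; abel)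
    fun x hx y hy => by
      convert hbox (c₂ + x) (b₁ + y) (by omega) (by omega) using 2
      rw [add_smul, add_smul]; abel
  convert this using 1
  rw [add_smul, add_smul]; abel

variable [DecidableEq D] (h : IsGradedMatrixRing w δ ρ)

theorem projDimLT_degreeSubmodule_Ici {d : D} {c b : ℕ} (n : ℕ)
    (hs : d + (c • w 0 + b • w 1) ∈ Set.range δ) :
    ProjDimLT Λ (n + 1) (h.degreeSubmodule d (UpperSet.Ici (expPair c b))) := by
  obtain ⟨t, ht⟩ := hs
  have := h.projective_degreeSubmodule_Ici t (expPair c b)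
  rw [ht, weight_expPair, add_sub_cancel_right] at this
  exact ProjDimLT.of_projective (by omega)

theorem projDimLT_staircase (hgen : ∀ d : D, ∃ c : ℕ, d + c • w 0 ∈ Set.range δ)
    (hT : CornerClosed w (Set.range δ)) (d : D) (b : ℕ) :
    ProjDimLT Λ 2 (h.degreeSubmodule d (staircase (Set.range δ) w d b)) ∧
      ∃ c β : ℕ, β ≤ b ∧ d + (c • w 0 + β • w 1) ∈ Set.range δ ∧
        ∀ c' β' : ℕ, β' ≤ b → d + (c' • w 0 + β' • w 1) ∈ Set.range δ → c ≤ c' := by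
  classical
  have hrow : ∀ β : ℕ, ∃ c : ℕ, d + (c • w 0 + β • w 1) ∈ Set.range δ := fun β => by
    obtain ⟨c, hc⟩ := hgen (d + β • w 1)
    exact ⟨c, by convert hc using 1; abel⟩
  induction b with
  | zero =>
    have hs := Nat.find_spec (hrow 0)
    have hmin := fun c => Nat.find_min' (hrow 0) (m := c)
    set c := Nat.find (hrow 0)
    refine ⟨?_, c, 0, le_rfl, hs, fun c' β' hβ' hc' => ?_⟩
    · rw [show staircase (Set.range δ) w d 0 = UpperSet.Ici (expPair c 0) by
        ext m
        rw [SetLike.mem_coe, SetLike.mem_coe, mem_staircase, mem_Ici_expPair]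
        constructor
        · rintro ⟨c', β, hβ, hs', h0, h1⟩
          obtain rfl : β = 0 := by omega
          exact ⟨(hmin _ hs').trans h0, h1⟩
        · exact fun hm => ⟨c, 0, le_rfl, hs, hm⟩]
      exact h.projDimLT_degreeSubmodule_Ici 1 hs
    · obtain rfl : β' = 0 := by omega
      exact hmin _ hc'
  | succ b ih =>
    obtain ⟨hU, C, β, hβ, hC, hCmin⟩ := ih
    have hs := Nat.find_spec (hrow (b + 1))
    have hmin := fun c => Nat.find_min' (hrow (b + 1)) (m := c)
    set c := Nat.find (hrow (b + 1))
    by_cases hcC : C ≤ c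
    · refine ⟨?_, C, β, hβ.trans b.le_succ, hC, fun c' β' hβ' hc' => ?_⟩
      · rwa [show staircase (Set.range δ) w d (b + 1) = staircase (Set.range δ) w d b by
          ext m
          rw [SetLike.mem_coe, SetLike.mem_coe, mem_staircase, mem_staircase]
          constructor
          · rintro ⟨c', β', hβ', hs', h0, h1⟩
            by_cases hb : β' ≤ b
            · exact ⟨c', β', hb, hs', h0, h1⟩
            · obtain rfl : β' = b + 1 := by omega
              exact ⟨C, β, hβ, hC, hcC.trans ((hmin _ hs').trans h0), by omega⟩
          · rintro ⟨c', β', hβ', hs'⟩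
            exact ⟨c', β', by omega, hs'⟩]
      · by_cases hb : β' ≤ b
        · exact hCmin c' β' hb hc'
        · obtain rfl : β' = b + 1 := by omega
          exact hcC.trans (hmin _ hc')
    · push Not at hcC
      have hcorner : d + (C • w 0 + (b + 1) • w 1) ∈ Set.range δ :=
        hT.apply hcC.le (by omega) hC hs fun x y hx hy hxy =>
          absurd (hCmin x y (by omega) hxy) (by omega)
      refine ⟨?_, c, b + 1, le_rfl, hs, fun c' β' hβ' hc' => ?_⟩
      · rw [show staircase (Set.range δ) w d (b + 1) =
            staircase (Set.range δ) w d b ⊓ UpperSet.Ici (expPair c (b + 1)) by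
          ext m
          rw [SetLike.mem_coe, SetLike.mem_coe, UpperSet.mem_inf_iff, mem_staircase,
            mem_staircase, mem_Ici_expPair]
          constructor
          · rintro ⟨c', β', hβ', hs', h0, h1⟩
            by_cases hb : β' ≤ b
            · exact Or.inl ⟨c', β', hb, hs', h0, h1⟩
            · obtain rfl : β' = b + 1 := by omega
              exact Or.inr ⟨(hmin _ hs').trans h0, h1⟩
          · rintro (⟨c', β', hβ', hs'⟩ | hm)
            · exact ⟨c', β', by omega, hs'⟩
            · exact ⟨c, b + 1, le_rfl, hs, hm⟩, degreeSubmodule_inf]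
        refine ProjDimLT.sup ?_ hU (h.projDimLT_degreeSubmodule_Ici 1 hs)
        rw [← degreeSubmodule_sup, show staircase (Set.range δ) w d b ⊔
            UpperSet.Ici (expPair c (b + 1)) = UpperSet.Ici (expPair C (b + 1)) by
          ext m
          rw [SetLike.mem_coe, SetLike.mem_coe, UpperSet.mem_sup_iff, mem_staircase,
            mem_Ici_expPair, mem_Ici_expPair]
          constructor
          · rintro ⟨⟨c', β', hβ', hs', h0, h1⟩, h2, h3⟩
            exact ⟨(hCmin c' β' hβ' hs').trans h0, h3⟩
          · rintro ⟨h0, h1⟩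
            exact ⟨⟨C, β, hβ, hC, h0, by omega⟩, by omega, h1⟩]
        exact h.projDimLT_degreeSubmodule_Ici 0 hcorner
      · by_cases hb : β' ≤ b
        · exact hcC.le.trans (hCmin c' β' hb hc')
        · obtain rfl : β' = b + 1 := by omega
          exact hmin _ hc'

theorem projDimLT_two_colMod [Fintype D] (h : IsGradedMatrixRing w δ ρ)
    (hgen : ∀ d : D, ∃ c : ℕ, d + c • w 0 ∈ Set.range δ)
    (hT : CornerClosed w (Set.range δ)) :
    ProjDimLT Λ 2 (ColMod ρ (MvPolynomial (Fin 2) K)) := by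
  refine h.projDimLT_colMod fun d => ?_
  have hcard : Fintype.card D • w 1 = 0 := card_nsmul_eq_zero
  have hpos : 0 < Fintype.card D := Fintype.card_pos
  set r := Fintype.card D
  rw [show h.degreeSubmodule d ⊥ = h.degreeSubmodule d (staircase (Set.range δ) w d r) by
    ext v
    rw [mem_degreeSubmodule, mem_degreeSubmodule]
    refine forall₂_congr fun q m => forall_congr' fun _ => and_congr_right fun hm => ?_
    refine ⟨fun _ => ?_, fun _ => UpperSet.mem_bot⟩
    refine ⟨m 0, m 1 % r, (Nat.mod_lt _ hpos).le, ⟨q, ?_⟩, le_rfl, Nat.mod_le _ _⟩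
    rw [eq_expPair m, weight_expPair] at hm
    rw [← hm, ← Nat.mod_add_div (m 1) r]
    simp [add_smul, mul_comm r, mul_smul, hcard]]
  exact (h.projDimLT_staircase hgen hT d r).1

theorem projDimLT_one_colMod [Fintype D] (h : IsGradedMatrixRing w δ ρ)
    (hT : ∀ d, d ∈ Set.range δ) :
    ProjDimLT Λ 1 (ColMod ρ (MvPolynomial (Fin 2) K)) := by
  refine h.projDimLT_colMod fun d => ?_
  have := h.projDimLT_degreeSubmodule_Ici (d := d) (c := 0) (b := 0) 0 (hT _)
  rwa [show UpperSet.Ici (expPair 0 0) = ⊥ by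
    ext m; simp only [SetLike.mem_coe, mem_Ici_expPair, UpperSet.mem_bot]; simp] at this

end IsGradedMatrixRing

end Staircase

section LowerBound

variable {K D : Type} [Field K] [AddCommGroup D] {w : Fin 2 → D}
  {ι Λ : Type} [Ring Λ] [Fintype ι] [DecidableEq ι] {δ : ι → D}
  {ρ : Λ →+* Matrix ι ι (MvPolynomial (Fin 2) K)}

namespace IsGradedMatrixRing

theorem exists_monomial {σ : Type} {w : σ → D} {ρ : Λ →+* Matrix ι ι (MvPolynomial σ K)}
    (h : IsGradedMatrixRing w δ ρ) (q p : ι) (e : σ →₀ ℕ)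
    (he : Finsupp.weight w e = δ q - δ p) : ∃ l, ρ l = Matrix.single q p (monomial e 1) := by
  refine h.exists_eq _ fun s t => ?_
  rw [Matrix.single_apply]
  split_ifs with hst
  · rw [← hst.1, ← hst.2]
    exact isWeightedHomogeneous_monomial w e 1 he
  · exact isWeightedHomogeneous_zero K w _

variable [DecidableEq D] (h : IsGradedMatrixRing w δ ρ)

/-- An element of the dual of `degreeSubmodule`, evaluated on two monomial columns with exponents
`(c, b)` and `(c', b')`, `c' < c`, is divisible by `x ^ (c - c')` on the first one. -/
theorem coeff_dual_eq_zero [Fintype D] {d : D} {U : UpperSet (Fin 2 →₀ ℕ)} {q q' : ι}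
    {c b c' b' : ℕ} (hq : δ q = d + (c • w 0 + b • w 1)) (hq' : δ q' = d + (c' • w 0 + b' • w 1))
    (hcol : h.monomialCol q (expPair c b) ∈ h.degreeSubmodule d U)
    (hcol' : h.monomialCol q' (expPair c' b') ∈ h.degreeSubmodule d U) (hc : c' ≤ c)
    (f : h.degreeSubmodule d U →ₗ[Λ] Λ) (j : ι) (m : Fin 2 →₀ ℕ) (hm : m 0 < c - c') :
    coeff m (ρ (f ⟨_, hcol⟩) q j) = 0 := by
  have hr : Fintype.card D • w 1 = 0 := card_nsmul_eq_zero
  have hpos : 0 < Fintype.card D := Fintype.card_pos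
  set r := Fintype.card D
  have hle : b' ≤ b + r * b' := by nlinarith
  obtain ⟨l, hl⟩ := h.exists_monomial q q (expPair 0 (r * b')) (by
    rw [weight_expPair, zero_smul, mul_comm, mul_smul, hr, smul_zero, zero_add, sub_self])
  obtain ⟨l', hl'⟩ := h.exists_monomial q q' (expPair (c - c') (b + r * b' - b')) (by
    rw [weight_expPair, hq, hq', sub_nsmul _ hc, sub_nsmul _ hle, add_smul b, mul_comm r, mul_smul,
      hr, smul_zero]
    abel)
  have hrel : l • (⟨_, hcol⟩ : h.degreeSubmodule d U) = l' • ⟨_, hcol'⟩ := by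
    refine Subtype.ext ?_
    change l • h.monomialCol q (expPair c b) = l' • h.monomialCol q' (expPair c' b')
    ext s : 1
    rw [smul_monomialCol_apply, smul_monomialCol_apply, hl, hl', Matrix.single_apply,
      Matrix.single_apply]
    simp only [and_true]
    split_ifs
    · rw [monomial_mul, monomial_mul]
      congr 2
      ext i
      fin_cases i <;> simp <;> omega
    · simp
  have hf := congrArg (fun x => ρ (f x) q j) hrel
  simp only [map_smul, smul_eq_mul, map_mul, hl, hl', Matrix.mul_apply] at hf
  simp only [Matrix.single_apply, true_and, ite_mul, zero_mul, Finset.sum_ite_eq, Finset.mem_univ,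
    if_true] at hf
  have hco := congrArg (coeff (expPair 0 (r * b') + m)) hf
  rw [coeff_monomial_mul, one_mul, coeff_monomial_mul', if_neg] at hco
  · exact hco
  · intro hle'
    have := hle' 0
    simp at this
    omega

theorem not_projective_degreeSubmodule [Fintype D] {d : D} {U : UpperSet (Fin 2 →₀ ℕ)}
    {c b c' b' : ℕ} (hU : ∀ u ∈ U, c' ≤ u 0 ∧ b ≤ u 1)
    (hne : expPair c' b ∈ U → d + (c' • w 0 + b • w 1) ∉ Set.range δ)
    (hmem : expPair c b ∈ U) (hs : d + (c • w 0 + b • w 1) ∈ Set.range δ)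
    (hmem' : expPair c' b' ∈ U) (hs' : d + (c' • w 0 + b' • w 1) ∈ Set.range δ) (hc : c' < c) :
    ¬ Module.Projective Λ (h.degreeSubmodule d U) := by
  intro hproj
  obtain ⟨s, hsec⟩ := Module.projective_def.1 hproj
  obtain ⟨q, hq⟩ := hs
  obtain ⟨q', hq'⟩ := hs'
  have hcol : ∀ {q : ι} {c b : ℕ}, δ q = d + (c • w 0 + b • w 1) → expPair c b ∈ U →
      h.monomialCol q (expPair c b) ∈ h.degreeSubmodule d U := fun hq hm =>
    h.monomialCol_mem (mem_atDegree.2 ⟨by rw [hq, weight_expPair, add_sub_cancel_right], hm⟩)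
  have hk := congrArg (fun x => coeff (expPair c b) (x.1 q)) (hsec ⟨_, hcol hq hmem⟩)
  simp only [monomialCol, if_true, coeff_monomial] at hk
  rw [Finsupp.linearCombination_apply, Finsupp.sum] at hk
  refine one_ne_zero (α := K) (hk.symm.trans ?_)
  have happ : ∀ (F : Finset (h.degreeSubmodule d U)) (k : h.degreeSubmodule d U → Λ),
      coeff (expPair c b) ((∑ i ∈ F, k i • id i : h.degreeSubmodule d U).1 q) =
        ∑ i ∈ F, ∑ j, coeff (expPair c b) (ρ (k i) q j * i.1 j) := by
    intro F k
    induction F using Finset.cons_induction with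
    | empty => exact coeff_zero _
    | cons i F hi ih =>
      rw [Finset.sum_cons, Finset.sum_cons, ← ih]
      change coeff _ ((k i • i.1) q + _) = _
      rw [coeff_add, ColMod.smul_apply, coeff_sum]
      rfl
  rw [happ]
  refine Finset.sum_eq_zero fun i _ => Finset.sum_eq_zero fun j _ => ?_
  rw [coeff_mul]
  refine Finset.sum_eq_zero fun ⟨u, v⟩ huv => ?_
  rw [Finset.HasAntidiagonal.mem_antidiagonal] at huv
  dsimp only at huv ⊢
  by_contra huv0
  have hv := h.mem_degreeSubmodule.1 i.2 j v (right_ne_zero_of_mul huv0)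
  have hu : ¬ u 0 < c - c' := fun hlt => left_ne_zero_of_mul huv0
    (h.coeff_dual_eq_zero hq hq' (hcol hq hmem) (hcol hq' hmem') hc.le
      (Finsupp.lapply i ∘ₗ s) j u hlt)
  have h0 := DFunLike.congr_fun huv 0
  have h1 := DFunLike.congr_fun huv 1
  simp only [Finsupp.add_apply, expPair_zero, expPair_one] at h0 h1
  have hv' := hU v hv.2
  have hveq : v = expPair c' b := by
    rw [eq_expPair v]
    congr 1 <;> omega
  rw [hveq, weight_expPair] at hv
  exact hne hv.2 ⟨j, by rw [← hv.1, sub_add_cancel]⟩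

theorem not_projective_nonzero [Fintype D] (h0 : 0 ∈ Set.range δ) : ¬ Module.Projective Λ
    (h.degreeSubmodule 0 (UpperSet.Ici (expPair 1 0) ⊓ UpperSet.Ici (expPair 0 1))) := by
  have hpos : 0 < Fintype.card D := Fintype.card_pos
  refine h.not_projective_degreeSubmodule (c := Fintype.card D) (b := 0) (c' := 0)
    (b' := Fintype.card D) (fun _ _ => ⟨Nat.zero_le _, Nat.zero_le _⟩) (fun hmem => ?_) ?_ ?_ ?_ ?_
    hpos
  · simp [expPair_le_iff] at hmem
  · exact Or.inl (mem_Ici_expPair.2 (by simpa using Nat.succ_le_of_lt hpos))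
  · simpa [card_nsmul_eq_zero] using h0
  · exact Or.inr (mem_Ici_expPair.2 (by simpa using Nat.succ_le_of_lt hpos))
  · simpa [card_nsmul_eq_zero] using h0

theorem not_projective_Ici [Fintype D] {d : D} {c b : ℕ}
    (hgen₀ : ∀ d : D, ∃ c : ℕ, d + c • w 0 ∈ Set.range δ)
    (hgen₁ : ∀ d : D, ∃ c : ℕ, d + c • w 1 ∈ Set.range δ)
    (hs : d + (c • w 0 + b • w 1) ∉ Set.range δ) :
    ¬ Module.Projective Λ (h.degreeSubmodule d (UpperSet.Ici (expPair c b))) := by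
  obtain ⟨x, hx⟩ := hgen₀ (d + (c • w 0 + b • w 1))
  obtain ⟨y, hy⟩ := hgen₁ (d + (c • w 0 + b • w 1))
  have hx0 : x ≠ 0 := by
    rintro rfl
    exact hs (by simpa using hx)
  refine h.not_projective_degreeSubmodule (c := c + x) (b := b) (c' := c) (b' := b + y)
    (fun u hu => mem_Ici_expPair.1 hu) (fun _ => hs) (mem_Ici_expPair.2 (by simp)) ?_
    (mem_Ici_expPair.2 (by simp)) ?_ (by omega)
  · convert hx using 1
    rw [add_smul]; abel
  · convert hy using 1
    rw [add_smul]; abel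

theorem not_glDimLT_three [Fintype D] (h : IsGradedMatrixRing w δ ρ)
    (hgen₀ : ∀ d : D, ∃ c : ℕ, d + c • w 0 ∈ Set.range δ)
    (hgen₁ : ∀ d : D, ∃ c : ℕ, d + c • w 1 ∈ Set.range δ)
    (hT : CornerClosed w (Set.range δ)) (h₀ : w 0 ∈ Set.range δ) (h₁ : w 1 ∈ Set.range δ)
    (hs : w 0 + w 1 ∉ Set.range δ) : ¬ GlDimLT Λ 3 := by
  intro hgl
  let N := h.degreeSubmodule 0 (UpperSet.Ici (expPair 1 0) ⊓ UpperSet.Ici (expPair 0 1))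
  have hN : ProjDimLT Λ 2 N := ProjDimLT.left (Submodule.injective_subtype N)
    (LinearMap.exact_subtype_mkQ N) (Submodule.mkQ_surjective N)
    (h.projDimLT_two_colMod hgen₀ hT) (hgl _)
  rw [show N = _ from h.degreeSubmodule_inf _ _ _] at hN
  have hI := hN.inf (h.projDimLT_degreeSubmodule_Ici 0 (by simpa using h₀))
    (h.projDimLT_degreeSubmodule_Ici 0 (by simpa using h₁))
  rw [← degreeSubmodule_sup, show UpperSet.Ici (expPair 1 0) ⊔ UpperSet.Ici (expPair 0 1) =
      UpperSet.Ici (expPair 1 1) by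
    ext m; simp only [SetLike.mem_coe, UpperSet.mem_sup_iff, mem_Ici_expPair]; omega] at hI
  exact h.not_projective_Ici hgen₀ hgen₁ (by simpa using hs) (ProjDimLT.one_iff.1 hI)

theorem not_glDimLT_two [Fintype D] (h : IsGradedMatrixRing w δ ρ)
    (hT : ∀ d, d ∈ Set.range δ) : ¬ GlDimLT Λ 2 := by
  intro hgl
  let N := h.degreeSubmodule 0 (UpperSet.Ici (expPair 1 0) ⊓ UpperSet.Ici (expPair 0 1))
  have hN : ProjDimLT Λ 1 N := ProjDimLT.left (Submodule.injective_subtype N)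
    (LinearMap.exact_subtype_mkQ N) (Submodule.mkQ_surjective N)
    (h.projDimLT_one_colMod hT) (hgl _)
  exact h.not_projective_nonzero (hT 0) (ProjDimLT.one_iff.1 hN)

end IsGradedMatrixRing

end LowerBound

section HirzebruchJung

theorem one_lt_hj_s14 : ∀ L : List ℚ, L ≠ [] → (∀ q ∈ L, 2 ≤ q) → 1 < hj L
  | [], h, _ => absurd rfl h
  | [q], _, h => by
    have := h q (by simp)
    simp only [hj]
    norm_num
    linarith
  | q :: p :: L, _, h => by
    have hL := one_lt_hj_s14 (p :: L) (by simp) fun x hx => h x (by simp_all)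
    have hq := h q (by simp)
    have : 1 / hj (p :: L) < 1 := by
      rw [div_lt_one (by linarith)]
      exact hL
    rw [hj]
    linarith

theorem ser_succ (x₀ x₁ : ℤ) (α : ℕ → ℕ) : ∀ t, ser x₀ x₁ α (t + 1) =
    ser x₁ (α 1 * x₁ - x₀) (fun s => α (s + 1)) t
  | 0 => rfl
  | 1 => rfl
  | t + 2 => by
    rw [ser, ser_succ x₀ x₁ α (t + 1), ser_succ x₀ x₁ α t]
    rfl

theorem ser_of_hj_eq {n : ℕ} {α : ℕ → ℕ} {x₀ x₁ : ℤ} (hx : 0 < x₁)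
    (hα : ∀ t, 1 ≤ t → t ≤ n + 1 → 2 ≤ α t)
    (hval : hj ((List.range (n + 1)).map fun t => (α (t + 1) : ℚ)) = (x₀ : ℚ) / x₁) :
    (∀ t ≤ n + 1, ser x₀ x₁ α (t + 1) < ser x₀ x₁ α t) ∧ ser x₀ x₁ α (n + 2) = 0 := by
  have hx' : (0 : ℚ) < x₁ := by exact_mod_cast hx
  have hgt : x₁ < x₀ := by
    have := one_lt_hj_s14 ((List.range (n + 1)).map fun t => (α (t + 1) : ℚ)) (by simp) (by
      simp only [List.mem_map, List.mem_range]
      rintro q ⟨t, ht, rfl⟩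
      exact_mod_cast hα (t + 1) (by omega) (by omega))
    rw [hval, one_lt_div hx'] at this
    exact_mod_cast this
  induction n generalizing α x₀ x₁ with
  | zero =>
    have h : (α 1 : ℚ) * x₁ = x₀ := by
      rw [eq_div_iff hx'.ne'] at hval
      simpa [hj] using hval
    have h' : (α 1 : ℤ) * x₁ - x₀ = 0 := by
      rw [sub_eq_zero]
      exact_mod_cast h
    have h2 : ser x₀ x₁ α 2 = 0 := h'
    refine ⟨fun t ht => ?_, h2⟩
    interval_cases t
    · exact hgt
    · rw [h2]; exact hx
  | succ n ih =>
    rw [List.range_succ_eq_map, List.map_cons, List.map_map, hj] at hval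
    set L := (List.range (n + 1)).map ((fun t => (α (t + 1) : ℚ)) ∘ Nat.succ) with hL
    have hL1 : 1 < hj L := one_lt_hj_s14 _ (by simp [hL]) (by
      simp only [hL, List.mem_map, List.mem_range]
      rintro q ⟨t, ht, rfl⟩
      change (2 : ℚ) ≤ (α (t + 2) : ℚ)
      exact_mod_cast hα (t + 2) (by omega) (by omega))
    set x₂ := (α 1 : ℤ) * x₁ - x₀ with hx₂
    have hx2q : (x₂ : ℚ) = x₁ / hj L := by
      rw [hx₂]
      push_cast
      field_simp at hval ⊢
      simp only [zero_add] at hval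
      linarith
    have hpos : 0 < x₂ := by
      have : (0 : ℚ) < x₂ := by rw [hx2q]; positivity
      exact_mod_cast this
    have hpos' : (0 : ℚ) < x₂ := by exact_mod_cast hpos
    have hlt : x₂ < x₁ := by
      have : (x₂ : ℚ) < x₁ := by
        rw [hx2q]
        exact div_lt_self hx' hL1
      exact_mod_cast this
    obtain ⟨h1, h2⟩ := ih (α := fun s => α (s + 1)) hpos (fun t h1 h2 => hα _ (by omega) (by omega))
      (show hj L = _ by rw [hx2q]; field_simp) hpos' hlt
    refine ⟨fun t ht => ?_, by rw [ser_succ, h2]⟩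
    rcases t with _ | t
    · exact hgt
    · rw [ser_succ x₀ x₁ α t, ser_succ x₀ x₁ α (t + 1)]
      exact h1 t (by omega)

/-- The properties of the `i`-series and the `j`-series of `r / a`. -/
structure IsHJSeries (r a n : ℕ) (I J : ℕ → ℤ) : Prop where
  I_zero : I 0 = r
  I_one : I 1 = a
  J_zero : J 0 = 0
  det (t : ℕ) : I t * J (t + 1) - I (t + 1) * J t = r
  congr (t : ℕ) : (I t : ZMod r) = a * J t
  I_lt (t : ℕ) : t ≤ n → I (t + 1) < I t
  J_lt (t : ℕ) : t ≤ n → J t < J (t + 1)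
  I_last : I n = 1
  I_end : I (n + 1) = 0

theorem isHJSeries_ser {r a n : ℕ} {α : ℕ → ℕ} (ha : 1 ≤ a) (hcop : Nat.Coprime r a) (hn : 1 ≤ n)
    (hα : ∀ t, 1 ≤ t → t ≤ n → 2 ≤ α t)
    (hval : hj ((List.range n).map fun t => (α (t + 1) : ℚ)) = (r : ℚ) / (a : ℚ)) :
    IsHJSeries r a n (ser r a α) (ser 0 1 α) := by
  obtain ⟨n, rfl⟩ := Nat.exists_eq_add_of_le' hn
  obtain ⟨h1, h2⟩ := ser_of_hj_eq (x₀ := r) (x₁ := a) (by exact_mod_cast ha) hα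
    (by rw [hval]; push_cast; rfl)
  have hrec : ∀ (y₀ y₁ : ℤ) (t : ℕ), ser y₀ y₁ α (t + 2) =
      α (t + 1) * ser y₀ y₁ α (t + 1) - ser y₀ y₁ α t := fun _ _ _ => rfl
  have hdet : ∀ t, ser r a α t * ser 0 1 α (t + 1) - ser r a α (t + 1) * ser 0 1 α t = r := by
    intro t
    induction t with
    | zero => simp [ser]
    | succ t ih =>
      rw [hrec r a t, hrec 0 1 t]
      linear_combination ih
  have hcong : ∀ t, (ser r a α t : ZMod r) = a * ser 0 1 α t ∧
      (ser r a α (t + 1) : ZMod r) = a * ser 0 1 α (t + 1) := by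
    intro t
    induction t with
    | zero => simp [ser]
    | succ t ih =>
      refine ⟨ih.2, ?_⟩
      rw [hrec r a t, hrec 0 1 t]
      push_cast
      rw [ih.1, ih.2]
      ring
  have hJ : ∀ t ≤ n + 1, 0 ≤ ser 0 1 α t ∧ ser 0 1 α t < ser 0 1 α (t + 1) := by
    intro t
    induction t with
    | zero => simp [ser]
    | succ t ih =>
      intro ht
      obtain ⟨h0, h1⟩ := ih (by omega)
      refine ⟨by omega, ?_⟩
      have : (2 : ℤ) ≤ α (t + 1) := by exact_mod_cast hα (t + 1) (by omega) (by omega)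
      rw [hrec 0 1 t]
      nlinarith
  have hgcd : ∀ t, IsCoprime (ser r a α t) (ser r a α (t + 1)) := by
    intro t
    induction t with
    | zero => exact Nat.isCoprime_iff_coprime.2 hcop
    | succ t ih =>
      rw [hrec r a t]
      rw [sub_eq_neg_add, mul_comm]
      exact ih.symm.neg_right.add_mul_left_right _
  have hlast : ser r a α (n + 1) = 1 := by
    have hu := hgcd (n + 1)
    rw [h2, isCoprime_zero_right, Int.isUnit_iff] at hu
    have := h1 (n + 1) le_rfl
    rw [h2] at this
    omega
  exact ⟨rfl, rfl, rfl, hdet, fun t => (hcong t).1, h1, fun t ht => (hJ t ht).2, hlast, h2⟩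

end HirzebruchJung

namespace IsHJSeries

variable {r a n : ℕ} {I J : ℕ → ℤ}

theorem I_anti (h : IsHJSeries r a n I J) {s t : ℕ} (hst : s ≤ t) (ht : t ≤ n + 1) : I t ≤ I s := by
  induction t, hst using Nat.le_induction with
  | base => rfl
  | succ t _ ih => exact (h.I_lt t (by omega)).le.trans (ih (by omega))

theorem J_mono (h : IsHJSeries r a n I J) {s t : ℕ} (hst : s ≤ t) (ht : t ≤ n + 1) : J s ≤ J t := by
  induction t, hst using Nat.le_induction with
  | base => rfl
  | succ t _ ih => exact (ih (by omega)).trans (h.J_lt t (by omega)).le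

theorem I_nonneg (h : IsHJSeries r a n I J) {t : ℕ} (ht : t ≤ n + 1) : 0 ≤ I t :=
  h.I_end ▸ h.I_anti ht le_rfl

theorem I_pos (h : IsHJSeries r a n I J) {t : ℕ} (ht : t ≤ n) : 1 ≤ I t :=
  h.I_last ▸ h.I_anti ht (by omega)

theorem J_nonneg (h : IsHJSeries r a n I J) {t : ℕ} (ht : t ≤ n + 1) : 0 ≤ J t :=
  h.J_zero ▸ h.J_mono t.zero_le ht

theorem J_pos (h : IsHJSeries r a n I J) {t : ℕ} (ht₀ : 1 ≤ t) (ht : t ≤ n + 1) : 1 ≤ J t := by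
  have h0 := h.J_lt 0 (by omega)
  have h1 := h.J_mono ht₀ ht
  rw [h.J_zero] at h0
  simp only [zero_add] at h0
  omega

theorem J_end (h : IsHJSeries r a n I J) : J (n + 1) = r := by
  have := h.det n
  rw [h.I_end, h.I_last] at this
  linarith

theorem r_pos (h : IsHJSeries r a n I J) : 1 ≤ r := by
  have := h.I_pos n.zero_le
  rw [h.I_zero] at this
  exact_mod_cast this

theorem mul_J_last (h : IsHJSeries r a n I J) : (a : ZMod r) * J n = 1 := by
  rw [← h.congr, h.I_last, Int.cast_one]

theorem exists_dvd (h : IsHJSeries r a n I J) {i j : ℤ} (hij : (i : ZMod r) = a * j) (t : ℕ) :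
    (r : ℤ) ∣ i * J t - I t * j := by
  rw [← ZMod.intCast_zmod_eq_zero_iff_dvd]
  push_cast
  rw [hij, h.congr]
  ring

theorem exists_le (h : IsHJSeries r a n I J) {i j : ℤ} (hi : 0 ≤ i) (hj : 0 ≤ j)
    (hne : i ≠ 0 ∨ j ≠ 0) (hij : (i : ZMod r) = a * j) : ∃ t ≤ n + 1, I t ≤ i ∧ J t ≤ j := by
  classical
  have hex : ∃ t, I t ≤ i := ⟨n + 1, by rwa [h.I_end]⟩
  have hle : Nat.find hex ≤ n + 1 := Nat.find_min' hex (by rwa [h.I_end])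
  refine ⟨Nat.find hex, hle, Nat.find_spec hex, ?_⟩
  obtain ht | ⟨s, hs⟩ : Nat.find hex = 0 ∨ ∃ s, Nat.find hex = s + 1 :=
    (Nat.find hex).eq_zero_or_eq_succ_pred.imp_right fun h => ⟨_, h⟩
  · rwa [ht, h.J_zero]
  have h1 := Nat.find_spec hex
  have h2 : i < I s := not_le.1 (Nat.find_min hex (by omega))
  rw [hs] at hle h1 ⊢
  by_contra! hlt
  obtain ⟨p, hp⟩ := h.exists_dvd hij (s + 1)
  obtain ⟨q, hq⟩ := h.exists_dvd hij s
  have hr : (0 : ℤ) < r := by exact_mod_cast h.r_pos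
  have hdet := h.det s
  have ei : i = p * I s - q * I (s + 1) := by
    apply mul_left_cancel₀ hr.ne'
    linear_combination (-i) * hdet + I s * hp - I (s + 1) * hq
  have ej : j = p * J s - q * J (s + 1) := by
    apply mul_left_cancel₀ hr.ne'
    linear_combination (-j) * hdet + J s * hp - J (s + 1) * hq
  have hI := h.I_nonneg hle
  have hI' := h.I_lt s (by omega)
  have hJ := h.J_nonneg (show s ≤ n + 1 by omega)
  have hJ' := h.J_lt s (by omega)
  have hp0 : 0 ≤ p := by
    by_contra! hp0
    nlinarith
  rcases hp0.eq_or_lt with rfl | hp1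
  · have hq0 : q = 0 := by
      by_contra! hq0
      rcases lt_or_gt_of_ne hq0 with hq0 | hq0 <;> nlinarith
    subst hq0
    simp at ei ej
    omega
  · have hq1 : 1 ≤ q := by
      by_contra! hq1
      nlinarith
    have hpq : q + 1 ≤ p := by
      by_contra! hpq
      nlinarith
    nlinarith

theorem false_of_lt (h : IsHJSeries r a n I J) {i j : ℤ} (hi : 0 ≤ i) (hj : 0 ≤ j)
    (hne : i ≠ 0 ∨ j ≠ 0) (hij : (i : ZMod r) = a * j)
    {t : ℕ} (ht : t ≤ n + 1) (hit : i < I t) (hjt : j < J t) :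
    False := by
  obtain ⟨s, hs, h1, h2⟩ := h.exists_le hi hj hne hij
  rcases le_total s t with hst | hst
  · have := h.I_anti hst ht
    omega
  · have := h.J_mono hst hs
    omega

/-- The degrees of the special modules. -/
abbrev degree (r n : ℕ) (I : ℕ → ℤ) (p : Fin (n + 1)) : ZMod r := (I p : ZMod r)

theorem mem_range (h : IsHJSeries r a n I J) {t : ℕ} (ht : t ≤ n + 1) :
    (I t : ZMod r) ∈ Set.range (degree r n I) := by
  rcases ht.eq_or_lt with rfl | ht
  · exact ⟨0, by simp [degree, h.I_end, h.I_zero]⟩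
  · exact ⟨⟨t, ht⟩, rfl⟩

theorem zero_mem_range (h : IsHJSeries r a n I J) : (0 : ZMod r) ∈ Set.range (degree r n I) := by
  simpa [h.I_end] using h.mem_range le_rfl

theorem one_mem_range (h : IsHJSeries r a n I J) : (1 : ZMod r) ∈ Set.range (degree r n I) := by
  simpa [h.I_last] using h.mem_range (Nat.le_succ n)

theorem a_mem_range (h : IsHJSeries r a n I J) : (a : ZMod r) ∈ Set.range (degree r n I) := by
  simpa [h.I_one] using h.mem_range (t := 1) (by omega)

theorem exists_add_mem_range (h : IsHJSeries r a n I J) (d : ZMod r) :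
    ∃ c : ℕ, d + c • (1 : ZMod r) ∈ Set.range (degree r n I) := by
  have : NeZero r := ⟨by have := h.r_pos; omega⟩
  exact ⟨(-d).val, by simpa using h.zero_mem_range⟩

theorem exists_add_mul_mem_range (h : IsHJSeries r a n I J) (d : ZMod r) :
    ∃ c : ℕ, d + c • (a : ZMod r) ∈ Set.range (degree r n I) := by
  have : NeZero r := ⟨by have := h.r_pos; omega⟩
  refine ⟨(-d * J n).val, ?_⟩
  rw [nsmul_eq_mul, ZMod.natCast_zmod_val, mul_assoc, mul_comm (J n : ZMod r), h.mul_J_last]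
  simpa using h.zero_mem_range

theorem one_add_notMem_range (h : IsHJSeries r a n I J) (har : a + 1 < r) :
    (1 + a : ZMod r) ∉ Set.range (degree r n I) := by
  rintro ⟨⟨t, ht⟩, e⟩
  have e' : (I t : ZMod r) = ((1 + a : ℤ) : ZMod r) := by push_cast; exact e
  rw [ZMod.intCast_eq_intCast_iff_dvd_sub] at e'
  have hpos := h.I_pos (Nat.lt_succ_iff.1 ht)
  rcases Nat.eq_zero_or_pos t with rfl | ht0
  · rw [h.I_zero, dvd_sub_self_right] at e'
    have := Int.le_of_dvd (by omega) e'
    omega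
  · have h1 := h.I_anti ht0 (by omega)
    rw [h.I_one] at h1
    have := Int.le_of_dvd (by omega) e'
    omega

theorem mem_range_of_eq (h : IsHJSeries r a n I J) (har : a + 1 = r) (d : ZMod r) :
    d ∈ Set.range (degree r n I) := by
  have : NeZero r := ⟨by omega⟩
  by_cases hd : d = 0
  · exact hd ▸ h.zero_mem_range
  have ha : (a : ZMod r) = -1 := by
    rw [eq_neg_iff_add_eq_zero]
    have := ZMod.natCast_self r
    rw [← har] at this ⊢
    exact_mod_cast this
  have hpos : 0 < d.val := Nat.pos_of_ne_zero fun h0 => hd ((ZMod.val_eq_zero d).1 h0)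
  have hlt := d.val_lt
  obtain ⟨t, ht, h1, h2⟩ := h.exists_le (i := d.val) (j := r - d.val) (by omega) (by omega)
    (by omega) (by push_cast; rw [ha]; simp)
  have hI := h.I_nonneg ht
  have hJ := h.J_nonneg ht
  have hdvd : (r : ℤ) ∣ I t + J t := by
    rw [← ZMod.intCast_zmod_eq_zero_iff_dvd]
    push_cast
    rw [h.congr, ha]
    ring
  have hIJ : 0 < I t + J t := by
    rcases Nat.eq_zero_or_pos t with rfl | ht0
    · rw [h.I_zero]
      omega
    · have := h.J_pos ht0 ht
      omega
  have := Int.le_of_dvd hIJ hdvd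
  have e : I t = d.val := by omega
  have := h.mem_range ht
  rw [e] at this
  simpa using this

theorem le_of_congr {x j : ℤ} (hx : 0 ≤ x) (hj : j < r) (e : (x : ZMod r) = j) : j ≤ x := by
  rw [ZMod.intCast_eq_intCast_iff_dvd_sub] at e
  by_contra! hlt
  have := Int.le_of_dvd (by omega) e
  omega

theorem exists_of_mem_range (h : IsHJSeries r a n I J) {d : ZMod r}
    (hd : d ∈ Set.range (degree r n I)) :
    ∃ t, 1 ≤ t ∧ t ≤ n + 1 ∧ d = I t := by
  obtain ⟨⟨t, ht⟩, rfl⟩ := hd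
  rcases Nat.eq_zero_or_pos t with rfl | ht0
  · exact ⟨n + 1, by omega, le_rfl, by simp [h.I_end, degree, h.I_zero]⟩
  · exact ⟨t, ht0, by omega, rfl⟩

theorem cornerClosed (h : IsHJSeries r a n I J) : IsGradedMatrixRing.CornerClosed ![1, (a : ZMod r)]
    (Set.range (degree r n I)) := by
  intro e c b h₁ h₂ hbox
  have : NeZero r := ⟨by have := h.r_pos; omega⟩
  simp only [Matrix.cons_val_zero, Matrix.cons_val_one, nsmul_eq_mul, mul_one] at *
  rcases Nat.eq_zero_or_pos c with rfl | hc
  · simpa using h₂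
  rcases Nat.eq_zero_or_pos b with rfl | hb
  · simpa using h₁
  replace hbox : ∀ x y : ℤ, 0 ≤ x → x < c → 0 ≤ y → y < b → e + (x + y * a) ≠ 0 := by
    intro x y hx hxc hy hyb h0
    lift x to ℕ using hx
    lift y to ℕ using hy
    refine hbox x (by omega) y (by omega) ?_
    push_cast at h0
    rw [h0]
    exact h.zero_mem_range
  obtain ⟨⟨t₁, ht₁⟩, e₁⟩ := h₁
  obtain ⟨t₂, ht₂, ht₂', e₂⟩ := h.exists_of_mem_range h₂
  replace e₁ : (I t₁ : ZMod r) = e + c := e₁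
  set τ : ZMod r := e + (c + b * a) with hτ
  by_cases hτ0 : τ = 0
  · rw [hτ0]
    exact h.zero_mem_range
  have hinv := h.mul_J_last
  obtain ⟨i, hi⟩ : ∃ i : ℤ, i = τ.val := ⟨_, rfl⟩
  obtain ⟨j, hj⟩ : ∃ j : ℤ, j = (τ * J n).val := ⟨_, rfl⟩
  have ei : (i : ZMod r) = τ := by simp [hi]
  have ej : a * (j : ZMod r) = τ := by
    rw [hj]
    simp only [Int.cast_natCast, ZMod.natCast_zmod_val]
    linear_combination τ * hinv
  have hir : i < r := by rw [hi]; exact_mod_cast τ.val_lt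
  have hjr : j < r := by rw [hj]; exact_mod_cast (τ * J n).val_lt
  have hi0 : 0 ≤ i := by omega
  have hj0 : 0 ≤ j := by omega
  have hi1 : i ≠ 0 := fun h0 => hτ0 (by rw [← ei, h0, Int.cast_zero])
  obtain ⟨t, ht, h3, h4⟩ := h.exists_le hi0 hj0 (.inl hi1) (ei.trans ej.symm)
  have ht0 : 1 ≤ t := by
    by_contra! ht0
    obtain rfl : t = 0 := by omega
    rw [h.I_zero] at h3
    omega
  have htn : t ≤ n := by
    by_contra! htn
    obtain rfl : t = n + 1 := by omega
    rw [h.J_end] at h4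
    omega
  have ht' := h.congr t
  rcases h3.eq_or_lt with h3 | h3
  · rw [← ei, ← h3]
    exact h.mem_range ht
  rcases h4.eq_or_lt with h4 | h4
  · rw [← ej, ← h4, ← ht']
    exact h.mem_range ht
  exfalso
  have hI := h.I_pos htn
  have hJ := h.J_pos ht0 ht
  have hI₁ := h.I_pos (Nat.lt_succ_iff.1 ht₁)
  have hJ₁ := h.J_nonneg ht₁.le
  have hI₂ := h.I_nonneg ht₂'
  have hJ₂ := h.J_pos ht₂ ht₂'
  have hc₁ := h.congr t₁
  have hc₂ := h.congr t₂
  have hjle : j ≤ J t₁ + b := by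
    refine le_of_congr (by omega) hjr ?_
    have : (a : ZMod r) * (J t₁ + b) = a * j := by
      rw [ej, mul_add, ← hc₁, e₁, hτ]
      ring
    push_cast
    linear_combination J n * this - (J t₁ + b - j) * hinv
  have hile : i ≤ I t₂ + c := by
    refine le_of_congr (by omega) hir ?_
    push_cast
    rw [ei, ← e₂, hτ]
    ring
  obtain ⟨x, hx⟩ : ∃ x : ℤ, x = c - i + I t := ⟨_, rfl⟩
  obtain ⟨y, hy⟩ : ∃ y : ℤ, y = b - J t := ⟨_, rfl⟩
  have hxy : e + (x + y * a) = 0 := by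
    rw [hx, hy]
    push_cast
    rw [ei, hτ, ht']
    ring
  have hy' : y < 0 → x ≤ c - I t₁ ∧ c - I t₁ < 0 := by
    intro hy0
    refine ⟨?_, ?_⟩
    · by_contra! hlt
      refine h.false_of_lt (i := x - c + I t₁) (j := -y) (by omega) (by omega) (by omega) ?_
        ht₁.le (by omega) (by omega)
      push_cast
      rw [e₁]
      linear_combination hxy
    · by_contra! hlt
      refine hbox (c - I t₁) 0 hlt (by omega) le_rfl (by omega) ?_
      push_cast
      rw [e₁]
      ring
  have hx' : x < 0 → y ≤ b - J t₂ ∧ b - J t₂ < 0 := by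
    intro hx0
    refine ⟨?_, ?_⟩
    · by_contra! hlt
      refine h.false_of_lt (t := t₂) (i := x + I t₂) (j := b - y) (by omega) (by omega) (by omega)
        ?_ ht₂' (by omega) (by omega)
      push_cast
      rw [← e₂]
      linear_combination hxy
    · by_contra! hlt
      refine hbox 0 (b - J t₂) le_rfl (by omega) hlt (by omega) ?_
      push_cast
      linear_combination e₂ + hc₂
  have hneg : x < 0 ∧ y < 0 := by
    by_cases hx0 : x < 0
    · have := hx' hx0
      omega
    · by_cases hy0 : y < 0
      · have := hy' hy0
        omega
      · exact absurd hxy (hbox x y (by omega) (by omega) (by omega) (by omega))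
  have h5 := hx' hneg.1
  have h6 := hy' hneg.2
  refine h.false_of_lt (t := t₂) (i := c - I t₁ + I t₂) (j := b) (by omega) (by omega) (by omega)
    ?_ ht₂' (by omega) (by omega)
  push_cast
  rw [e₁, ← e₂]
  ring

end IsHJSeries

section EndomorphismRing

variable {K D ι R : Type} [Field K] [AddCommGroup D] [CommRing R]
  [Algebra R (MvPolynomial (Fin 2) K)] {w : Fin 2 → D}

theorem exists_eq_mul_of_linearMap (hw : ∀ i d, ∃ u : ℕ, u • w i = d)
    (hR : ∀ f, IsWeightedHomogeneous w f 0 → ∃ s : R, algebraMap R (MvPolynomial (Fin 2) K) s = f)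
    {d e : D} {M N : Submodule R (MvPolynomial (Fin 2) K)}
    (hM : ∀ f, f ∈ M ↔ IsWeightedHomogeneous w f d)
    (hN : ∀ f, f ∈ N ↔ IsWeightedHomogeneous w f e) (φ : M →ₗ[R] N) :
    ∃ s, IsWeightedHomogeneous w s (e - d) ∧
      ∀ v : M, (φ v).1 = s * v.1 := by
  obtain ⟨u, hu⟩ := hw 0 d
  obtain ⟨b, hb⟩ := hw 1 d
  obtain ⟨c, hc⟩ := hw 0 (-d)
  have hXu : IsWeightedHomogeneous w (X 0 ^ u : MvPolynomial (Fin 2) K) d :=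
    hu ▸ (isWeightedHomogeneous_X K w 0).pow u
  have hXb : IsWeightedHomogeneous w (X 1 ^ b : MvPolynomial (Fin 2) K) d :=
    hb ▸ (isWeightedHomogeneous_X K w 1).pow b
  have hXc : IsWeightedHomogeneous w (X 0 ^ c : MvPolynomial (Fin 2) K) (-d) :=
    hc ▸ (isWeightedHomogeneous_X K w 0).pow c
  have hX : ∀ m : ℕ, (X 0 ^ m : MvPolynomial (Fin 2) K) ≠ 0 := fun m => pow_ne_zero _ (X_ne_zero 0)
  set x : M := ⟨X 0 ^ u, (hM _).2 hXu⟩ with hx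
  have key : ∀ v : M, X 0 ^ u * (φ v).1 = v.1 * (φ x).1 := by
    intro v
    obtain ⟨s, hs⟩ := hR (X 0 ^ c * v.1) (by simpa using hXc.mul ((hM _).1 v.2))
    obtain ⟨t, ht⟩ := hR (X 0 ^ c * x.1) (by simpa using hXc.mul ((hM _).1 x.2))
    have hst : t • v = s • x := by
      apply Subtype.ext
      rw [Submodule.coe_smul, Submodule.coe_smul, Algebra.smul_def, Algebra.smul_def, hs, ht]
      ring
    have := congrArg (fun y => ((φ y : N) : MvPolynomial (Fin 2) K)) hst
    simp only [map_smul, Submodule.coe_smul, Algebra.smul_def, hs, ht] at this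
    apply mul_left_cancel₀ (hX c)
    rw [← mul_assoc, ← mul_assoc]
    exact this
  have hdvd : (X 0 ^ u : MvPolynomial (Fin 2) K) ∣ (φ x).1 := by
    have h1 : (X 0 ^ u : MvPolynomial (Fin 2) K) ∣ X 1 ^ b * (φ x).1 :=
      ⟨_, (key ⟨X 1 ^ b, (hM _).2 hXb⟩).symm⟩
    refine (MvPolynomial.X_prime (i := 0)).pow_dvd_of_dvd_mul_left u (fun h => ?_) h1
    have := (MvPolynomial.X_prime (i := 0)).dvd_of_dvd_pow h
    rw [X_dvd_X] at this
    simp at this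
  obtain ⟨s, hs⟩ := hdvd
  refine ⟨s, fun m hm => ?_, fun v => ?_⟩
  · have h1 := (hN _).1 (φ x).2
    have h2 : coeff (m + Finsupp.single 0 u) (φ x).1 ≠ 0 := by
      rwa [hs, mul_comm, X_pow_eq_monomial, coeff_mul_monomial, mul_one]
    have h3 := h1 h2
    rw [map_add, Finsupp.weight_single, hu] at h3
    exact eq_sub_of_add_eq h3
  · apply mul_left_cancel₀ (hX u)
    rw [key, hs]
    ring

variable [Fintype ι] [DecidableEq ι]

theorem exists_isGradedMatrixRing_end (hw : ∀ i d, ∃ u : ℕ, u • w i = d)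
    (hR : ∀ f, IsWeightedHomogeneous w f 0 → ∃ s : R, algebraMap R (MvPolynomial (Fin 2) K) s = f)
    {δ : ι → D} {N : ι → Submodule R (MvPolynomial (Fin 2) K)}
    (hN : ∀ p f, f ∈ N p ↔ IsWeightedHomogeneous w f (δ p)) :
    ∃ ρ : Module.End R (∀ p, N p) →+* Matrix ι ι (MvPolynomial (Fin 2) K),
      IsGradedMatrixRing (Λ := Module.End R (∀ p, N p)) w δ ρ := by
  have hex (f : Module.End R (∀ p, N p)) (q p : ι) := exists_eq_mul_of_linearMap hw hR (hN p) (hN q)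
    (LinearMap.proj q ∘ₗ f ∘ₗ LinearMap.single R (fun p => N p) p)
  choose ρ hρ₁ hρ₂ using hex
  simp only [LinearMap.comp_apply, LinearMap.proj_apply, LinearMap.single_apply] at hρ₂
  have happ (f : Module.End R (∀ p, N p)) (x : ∀ p, N p) (q : ι) :
      (f x q : MvPolynomial (Fin 2) K) = ∑ p, ρ f q p * x p := by
    conv_lhs => rw [← Finset.univ_sum_single x]
    rw [map_sum, Finset.sum_apply, AddSubmonoidClass.coe_finsetSum]
    exact Finset.sum_congr rfl fun p _ => hρ₂ f q p (x p)
  have huniq (f : Module.End R (∀ p, N p)) (A : Matrix ι ι (MvPolynomial (Fin 2) K))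
      (hA : ∀ q x, (f x q : MvPolynomial (Fin 2) K) = ∑ p, A q p * x p) : ρ f = A := by
    ext q p : 2
    obtain ⟨u, hu⟩ := hw 0 (δ p)
    set x : N p := ⟨X 0 ^ u, (hN _ _).2 (hu ▸ (isWeightedHomogeneous_X K w 0).pow u)⟩
    have h1 := hA q (Pi.single p x)
    rw [hρ₂, Finset.sum_eq_single p (fun s _ hs => by simp [hs]) (by simp), Pi.single_eq_same] at h1
    exact mul_right_cancel₀ (pow_ne_zero _ (X_ne_zero 0)) h1
  refine ⟨
    { toFun := fun f => .of (ρ f)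
      map_one' := ?_
      map_mul' := ?_
      map_zero' := ?_
      map_add' := ?_ }, ⟨?_, hρ₁, ?_⟩⟩
  · refine huniq _ _ fun q x => ?_
    simp [Matrix.one_apply]
  · intro f f'
    refine huniq _ _ fun q x => ?_
    rw [Module.End.mul_apply, happ]
    simp only [happ, Matrix.mul_apply, Finset.mul_sum, Finset.sum_mul, Matrix.of_apply]
    rw [Finset.sum_comm]
    simp only [mul_assoc]
  · exact huniq _ _ fun q x => by simp
  · intro f f'
    refine huniq _ _ fun q x => ?_
    simp [happ, add_mul, Finset.sum_add_distrib]
  · intro f f' hff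
    refine LinearMap.ext fun x => funext fun q => Subtype.ext ?_
    rw [happ, happ]
    exact Finset.sum_congr rfl fun p _ => by rw [show ρ f = ρ f' from hff]
  · intro A hA
    have hmem (x : ∀ p, N p) (q : ι) : ∑ p, A q p * (x p : MvPolynomial (Fin 2) K) ∈ N q :=
      Submodule.sum_mem _ fun p _ => (hN _ _).2 <| by
        simpa using (hA q p).mul ((hN _ _).1 (x p).2)
    refine ⟨{ toFun := fun x q => ⟨_, hmem x q⟩, map_add' := ?_, map_smul' := ?_ },
      huniq _ _ fun q x => rfl⟩
    · intro x y
      refine funext fun q => Subtype.ext ?_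
      simp [mul_add, Finset.sum_add_distrib]
    · intro c x
      refine funext fun q => Subtype.ext ?_
      simp [Finset.smul_sum]

end EndomorphismRing

section Eigenspaces

variable {r a : ℕ} {ε : ℂ} {g : MvPolynomial (Fin 2) ℂ ≃ₐ[ℂ] MvPolynomial (Fin 2) ℂ}

theorem coeff_apply_of_diagonal (hgx : g (X 0) = C ε * X 0) (hgy : g (X 1) = C (ε ^ a) * X 1)
    (f : MvPolynomial (Fin 2) ℂ) (m : Fin 2 →₀ ℕ) :
    coeff m (g f) = ε ^ (m 0 + a * m 1) * coeff m f := by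
  induction f using MvPolynomial.induction_on' with
  | monomial u c =>
    have : g (monomial u c) = C (ε ^ (u 0 + a * u 1)) * monomial u c := by
      rw [monomial_eq, Finsupp.prod_fintype _ _ (by simp), Fin.prod_univ_two, map_mul, map_mul,
        map_pow, map_pow, hgx, hgy, ← algebraMap_eq, AlgEquiv.commutes, algebraMap_eq]
      simp only [C_mul, C_pow, pow_mul, pow_add]
      ring
    rw [this, coeff_C_mul, coeff_monomial]
    split_ifs with h
    · rw [h]
    · simp
  | add p q hp hq => rw [map_add, coeff_add, coeff_add, hp, hq, mul_add]

theorem apply_eq_iff_isWeightedHomogeneous [NeZero r] (hε : IsPrimitiveRoot ε r)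
    (hgx : g (X 0) = C ε * X 0) (hgy : g (X 1) = C (ε ^ a) * X 1) (k : ℕ)
    (f : MvPolynomial (Fin 2) ℂ) :
    g f = C (ε ^ k) * f ↔ IsWeightedHomogeneous ![1, (a : ZMod r)] f (k : ZMod r) := by
  rw [MvPolynomial.ext_iff]
  refine forall_congr' fun m => ?_
  have hw : Finsupp.weight ![1, (a : ZMod r)] m = ((m 0 + a * m 1 : ℕ) : ZMod r) := by
    rw [Finsupp.weight_apply, Finsupp.sum_fintype _ _ (by simp), Fin.sum_univ_two]
    simp [mul_comm]
  rw [coeff_apply_of_diagonal hgx hgy, coeff_C_mul, hw, ZMod.natCast_eq_natCast_iff,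
    hε.eq_orderOf, ← (hε.isOfFinOrder (NeZero.ne r)).pow_eq_pow_iff_modEq]
  constructor
  · intro h hm
    exact mul_right_cancel₀ hm h
  · intro h
    by_cases hm : coeff m f = 0
    · rw [hm, mul_zero, mul_zero]
    · rw [h hm]

end Eigenspaces

theorem exists_not_subsingleton_derived_ext {Λ : Type} [Ring Λ] {n : ℕ} (h : ¬ GlDimLT Λ (n + 1)) :
    ∃ M N : ModuleCat.{0} Λ,
      ¬ Subsingleton (((Ext ℤ (ModuleCat.{0} Λ) (n + 1)).obj (Opposite.op M)).obj N) := by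
  by_contra! hc
  exact h fun M _ _ => (forall_subsingleton_derived_ext_iff (ModuleCat.of Λ M) n).1 (hc _)

theorem GlDimLT.subsingleton_derived_ext {Λ : Type} [Ring Λ] {n : ℕ} (h : GlDimLT Λ (n + 1))
    (M N : ModuleCat.{0} Λ) :
    Subsingleton (((Ext ℤ (ModuleCat.{0} Λ) (n + 1)).obj (Opposite.op M)).obj N) :=
  (forall_subsingleton_derived_ext_iff M n).2 (h M) N

set_option synthInstance.maxHeartbeats 1000000 in
set_option maxHeartbeats 4000000 in
/-- the global dimension of the reconstruction algebra is 2 in the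
`SL(2,C)` case `a = r − 1` and 3 otherwise, expressed via vanishing/non-vanishing
of Ext groups of left modules. -/
theorem stmt_14 (r a n : ℕ) (α : ℕ → ℕ)
    (ha : 1 ≤ a) (har : a < r) (hcop : Nat.Coprime r a) (hn : 1 ≤ n)
    (hα : ∀ t, 1 ≤ t → t ≤ n → 2 ≤ α t)
    (hval : hj ((List.range n).map fun t => (α (t + 1) : ℚ)) = (r : ℚ) / (a : ℚ))
    (ε : ℂ) (hε : IsPrimitiveRoot ε r)
    (g : MvPolynomial (Fin 2) ℂ ≃ₐ[ℂ] MvPolynomial (Fin 2) ℂ)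
    (hgx : g (X 0) = C ε * X 0) (hgy : g (X 1) = C (ε ^ a) * X 1) :
    (a = r - 1 →
      (∀ M N : ModuleCat.{0} (Module.End (fixedSub g)
          ((p : Fin (n + 1)) → eigenSub g (ε ^ (ser r a α p.1).toNat))),
        Subsingleton (((Ext ℤ (ModuleCat.{0} (Module.End (fixedSub g)
          ((p : Fin (n + 1)) → eigenSub g (ε ^ (ser r a α p.1).toNat)))) 3).obj
            (Opposite.op M)).obj N)) ∧
      (∃ M N : ModuleCat.{0} (Module.End (fixedSub g)
          ((p : Fin (n + 1)) → eigenSub g (ε ^ (ser r a α p.1).toNat))),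
        ¬ Subsingleton (((Ext ℤ (ModuleCat.{0} (Module.End (fixedSub g)
          ((p : Fin (n + 1)) → eigenSub g (ε ^ (ser r a α p.1).toNat)))) 2).obj
            (Opposite.op M)).obj N))) ∧
    (a ≠ r - 1 →
      (∀ M N : ModuleCat.{0} (Module.End (fixedSub g)
          ((p : Fin (n + 1)) → eigenSub g (ε ^ (ser r a α p.1).toNat))),
        Subsingleton (((Ext ℤ (ModuleCat.{0} (Module.End (fixedSub g)
          ((p : Fin (n + 1)) → eigenSub g (ε ^ (ser r a α p.1).toNat)))) 4).obj
            (Opposite.op M)).obj N)) ∧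
      (∃ M N : ModuleCat.{0} (Module.End (fixedSub g)
          ((p : Fin (n + 1)) → eigenSub g (ε ^ (ser r a α p.1).toNat))),
        ¬ Subsingleton (((Ext ℤ (ModuleCat.{0} (Module.End (fixedSub g)
          ((p : Fin (n + 1)) → eigenSub g (ε ^ (ser r a α p.1).toNat)))) 3).obj
            (Opposite.op M)).obj N))) := by
  have : NeZero r := ⟨by omega⟩
  have h := isHJSeries_ser ha hcop hn hα hval
  have hmem (k : ℕ) (f : MvPolynomial (Fin 2) ℂ) :=
    apply_eq_iff_isWeightedHomogeneous hε hgx hgy k f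
  obtain ⟨ρ, hρ⟩ := exists_isGradedMatrixRing_end (K := ℂ) (R := fixedSub g)
    (w := ![1, (a : ZMod r)]) (δ := IsHJSeries.degree r n (ser r a α))
    (N := fun p : Fin (n + 1) => eigenSub g (ε ^ (ser r a α p.1).toNat))
    (by
      intro i d
      fin_cases i
      · exact ⟨d.val, by simp⟩
      · exact ⟨(d * ser 0 1 α n).val, by
          have := h.mul_J_last
          simp only [Fin.mk_one, Matrix.cons_val_one, Matrix.cons_val_fin_one, nsmul_eq_mul,
            ZMod.natCast_val, ZMod.cast_id]
          linear_combination d * this⟩)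
    (fun f hf => ⟨⟨f, by
      have h0 := (hmem 0 f).2 (by simpa using hf)
      rwa [pow_zero, C_1, one_mul] at h0⟩, rfl⟩)
    (fun p f => by
      have hp := h.I_pos (Nat.lt_succ_iff.1 p.2)
      have e : IsHJSeries.degree r n (ser r a α) p = ((ser r a α p.1).toNat : ZMod r) := by
        rw [← Int.cast_natCast ((ser r a α p.1).toNat), Int.toNat_of_nonneg (zero_le_one.trans hp)]
      rw [e]
      exact hmem _ f)
  have hS := GlDimLT.mvPolynomial ℂ 2
  refine ⟨fun har' => ?_, fun har' => ?_⟩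
  · have hall := h.mem_range_of_eq (by omega)
    exact ⟨(hρ.glDimLT (i := 2) (j := 0) hS
        (hρ.projDimLT_one_colMod hall)).subsingleton_derived_ext,
      exists_not_subsingleton_derived_ext (hρ.not_glDimLT_two hall)⟩
  · have hgen₀ (d : ZMod r) := h.exists_add_mem_range d
    have hgen₁ (d : ZMod r) := h.exists_add_mul_mem_range d
    exact ⟨(hρ.glDimLT (i := 2) (j := 1) hS
        (hρ.projDimLT_two_colMod hgen₀ h.cornerClosed)).subsingleton_derived_ext,
      exists_not_subsingleton_derived_ext (hρ.not_glDimLT_three hgen₀ hgen₁ h.cornerClosed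
        h.one_mem_range h.a_mem_range (h.one_add_notMem_range (by omega)))⟩
end

section
/- For all integers s and t, the map sending h ∈ S_{t−s} to the multiplication map (f ↦ h·f) is a ℂ-linear bijection from S_{t−s} onto the R-module Hom_R(S_s, S_t) of R-linear maps S_s → S_t; that is, every R-module homomorphism S_s → S_t is multiplication by a unique element of S_{t−s} (so Hom_R(S_s, S_t) ≅ S_{t−s}). -/
open MvPolynomial

section Homs

variable {g : MvPolynomial (Fin 2) ℂ ≃ₐ[ℂ] MvPolynomial (Fin 2) ℂ}

/-- Some power of an eigenvector of `g` has any prescribed eigenvalue that is an `r`-th root of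
unity, provided the eigenvalue of the vector is a primitive `r`-th root of unity. -/
theorem exists_pow_mem_eigenSub {r : ℕ} [NeZero r] {ζ c : ℂ} (hζ : IsPrimitiveRoot ζ r)
    (hc : c ^ r = 1) {v : MvPolynomial (Fin 2) ℂ} (hv : g v = C ζ * v) :
    ∃ n : ℕ, v ^ n ∈ eigenSub g c := by
  obtain ⟨n, -, rfl⟩ := hζ.eq_pow_of_pow_eq_one hc
  refine ⟨n, ?_⟩
  change g (v ^ n) = C (ζ ^ n) * v ^ n
  rw [map_pow, hv, mul_pow, C_pow]

theorem pow_mem_fixedSub {r : ℕ} {c : ℂ} (hc : c ^ r = 1) {f : MvPolynomial (Fin 2) ℂ}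
    (hf : g f = C c * f) : f ^ r ∈ fixedSub g := by
  change g (f ^ r) = f ^ r
  rw [map_pow, hf, mul_pow, ← C_pow, hc, C_1, one_mul]

theorem mul_pow_mem_fixedSub {k : ℕ} {c : ℂ} (hc : c ^ (k + 1) = 1)
    {f f' : MvPolynomial (Fin 2) ℂ} (hf : g f = C c * f) (hf' : g f' = C c * f') :
    f * f' ^ k ∈ fixedSub g := by
  change g (f * f' ^ k) = f * f' ^ k
  calc g (f * f' ^ k) = C (c ^ (k + 1)) * (f * f' ^ k) := by
        rw [map_mul, map_pow, hf, hf', mul_pow, C_pow]; ring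
    _ = f * f' ^ k := by rw [hc, C_1, one_mul]

set_option synthInstance.maxHeartbeats 1000000 in
set_option maxHeartbeats 4000000 in
/-- An `R`-linear map between eigenspaces is multiplication by a fixed rational function. -/
theorem mul_apply_eq_mul_apply {r : ℕ} (hr : r ≠ 0) {c d : ℂ} (hc : c ^ r = 1)
    (φ : eigenSub g c →ₗ[fixedSub g] eigenSub g d) (f f' : eigenSub g c) :
    (f' : MvPolynomial (Fin 2) ℂ) * φ f = f * φ f' := by
  obtain ⟨k, rfl⟩ := Nat.exists_eq_succ_of_ne_zero hr
  by_cases h0 : (f' : MvPolynomial (Fin 2) ℂ) = 0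
  · have : f' = 0 := Subtype.ext h0
    simp [this]
  let u : fixedSub g := ⟨(f' : MvPolynomial (Fin 2) ℂ) ^ (k + 1), pow_mem_fixedSub hc f'.2⟩
  let w : fixedSub g := ⟨(f : MvPolynomial (Fin 2) ℂ) * (f' : MvPolynomial (Fin 2) ℂ) ^ k,
    mul_pow_mem_fixedSub hc f.2 f'.2⟩
  have huw : u • f = w • f' := by
    apply Subtype.ext
    change (f' : MvPolynomial (Fin 2) ℂ) ^ (k + 1) * f = f * (f' : MvPolynomial (Fin 2) ℂ) ^ k * f'
    ring
  have h : u • φ f = w • φ f' := by rw [← map_smul, ← map_smul, huw]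
  have h' : (f' : MvPolynomial (Fin 2) ℂ) ^ (k + 1) * φ f
      = f * (f' : MvPolynomial (Fin 2) ℂ) ^ k * φ f' := congrArg Subtype.val h
  apply mul_left_cancel₀ (pow_ne_zero k h0)
  linear_combination h'

end Homs

set_option synthInstance.maxHeartbeats 1000000 in
set_option maxHeartbeats 4000000 in
/-- for all integers `s, t`, multiplication by elements of `S_{t−s}`
gives exactly the `R`-module homomorphisms `S_s → S_t`: the product of an element of
`S_{t−s}` with an element of `S_s` lies in `S_t`, and every `R`-linear map
`S_s → S_t` is multiplication by a unique element of `S_{t−s}`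
(so `Hom_R(S_s, S_t) ≅ S_{t−s}`). -/
theorem stmt_15 (r a : ℕ)
    (ha : 1 ≤ a) (har : a < r) (hcop : Nat.Coprime r a)
    (ε : ℂ) (hε : IsPrimitiveRoot ε r)
    (g : MvPolynomial (Fin 2) ℂ ≃ₐ[ℂ] MvPolynomial (Fin 2) ℂ)
    (hgx : g (X 0) = C ε * X 0) (hgy : g (X 1) = C (ε ^ a) * X 1) :
    ∀ s t : ℤ,
      (∀ h f : MvPolynomial (Fin 2) ℂ,
        g h = C (ε ^ (t - s)) * h → g f = C (ε ^ s) * f →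
        g (h * f) = C (ε ^ t) * (h * f)) ∧
      (∀ φ : eigenSub g (ε ^ s) →ₗ[fixedSub g] eigenSub g (ε ^ t),
        ∃! h : eigenSub g (ε ^ (t - s)),
          ∀ f : eigenSub g (ε ^ s),
            (φ f : MvPolynomial (Fin 2) ℂ) = (h : MvPolynomial (Fin 2) ℂ) * f) := by
  intro s t
  have hr : r ≠ 0 := by omega
  have : NeZero r := ⟨hr⟩
  have hε0 : ε ≠ 0 := hε.ne_zero hr
  have hts : ε ^ (t - s) * ε ^ s = ε ^ t := by rw [← zpow_add₀ hε0, sub_add_cancel]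
  refine ⟨fun h f hh hf => ?_, fun φ => ?_⟩
  · rw [map_mul, hh, hf, ← hts, C_mul]
    ring
  have hs : (ε ^ s) ^ r = 1 := by
    rw [← zpow_natCast, zpow_comm, zpow_natCast, hε.pow_eq_one, one_zpow]
  obtain ⟨n, hn⟩ := exists_pow_mem_eigenSub hε hs hgx
  obtain ⟨m, hm⟩ := exists_pow_mem_eigenSub (hε.pow_of_coprime a hcop.symm) hs hgy
  have hxn : (X 0 : MvPolynomial (Fin 2) ℂ) ^ n ≠ 0 := pow_ne_zero _ (X_ne_zero _)
  have hX : Prime (X 0 : MvPolynomial (Fin 2) ℂ) := X_prime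
  have hdvd : (X 0 : MvPolynomial (Fin 2) ℂ) ^ n ∣ φ ⟨_, hn⟩ := by
    refine hX.pow_dvd_of_dvd_mul_left n (a := (X 1 : MvPolynomial (Fin 2) ℂ) ^ m) (fun h => ?_)
      ⟨_, mul_apply_eq_mul_apply hr hs φ ⟨_, hn⟩ ⟨_, hm⟩⟩
    exact zero_ne_one (X_dvd_X.mp (hX.dvd_of_dvd_pow h))
  obtain ⟨h, hh⟩ := hdvd
  have hmem : h ∈ eigenSub g (ε ^ (t - s)) := by
    change g h = C (ε ^ (t - s)) * h
    have hφ : g (φ ⟨_, hn⟩ : MvPolynomial (Fin 2) ℂ) =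
        C (ε ^ t) * (φ ⟨_, hn⟩ : MvPolynomial (Fin 2) ℂ) := (φ ⟨_, hn⟩).2
    have hn' : g (X 0 ^ n) = C (ε ^ s) * X 0 ^ n := hn
    rw [hh, map_mul, hn', ← hts, C_mul] at hφ
    have hC : (C (ε ^ s) : MvPolynomial (Fin 2) ℂ) ≠ 0 := by
      simpa using zpow_ne_zero s hε0
    apply mul_left_cancel₀ (mul_ne_zero hC hxn)
    linear_combination hφ
  refine ⟨⟨h, hmem⟩, fun f => ?_, fun h' hh' => Subtype.ext ?_⟩
  · have := mul_apply_eq_mul_apply hr hs φ f ⟨_, hn⟩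
    rw [hh] at this
    apply mul_left_cancel₀ hxn
    linear_combination this
  · apply mul_right_cancel₀ hxn
    rw [← hh' ⟨_, hn⟩, hh, mul_comm]
end
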